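/- arXiv:2112.10172 — 2 statements merged into one kernel-verified Lean document; each statement's English description precedes it below -/
import Mathlib

section
/- The σ-product of complete Erdős space, σ𝔈_c, is homeomorphic to ℚ × 𝔈_c (where ℚ carries its usual topology). -/
/- Complete Erdős space 𝔈_c, realized inside the real Hilbert space ℓ². -/

noncomputable section
open Topology Filter TopologicalSpace

/-- The set of points of ℓ² all of whose coordinates lie in {0} ∪ {1/(m+1) : m ∈ ℕ}. -/
def ErdosSet : Set (lp (fun _ : ℕ => ℝ) 2) :=
  {x | ∀ n : ℕ, x n = 0 ∨ ∃ m : ℕ, x n = 1 / (m + 1)}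

/-- Complete Erdős space 𝔈_c, with the subspace (norm) topology from ℓ². -/
abbrev Ec := ↥ErdosSet

/-- The σ-product σ𝔈_c ⊆ 𝔈_c^ω : sequences which are the zero point of 𝔈_c in all but
finitely many coordinates, with the subspace topology from the product 𝔈_c^ω. -/
def sigmaErdos : Set (ℕ → Ec) :=
  {y | {n : ℕ | (y n : lp (fun _ : ℕ => ℝ) 2) ≠ 0}.Finite}

theorem exists_dependent_seq {α : Type*} {P : ℕ → α → Prop} {R : ℕ → α → α → Prop}
    (h0 : ∃ a, P 0 a) (hs : ∀ n a, P n a → ∃ a', P (n + 1) a' ∧ R n a a') :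
    ∃ f : ℕ → α, (∀ n, P n (f n)) ∧ ∀ n, R n (f n) (f (n + 1)) := by
  obtain ⟨a, ha⟩ := h0
  choose! g hg hR using hs
  have key : ∀ n, P n (Nat.rec (motive := fun _ => α) a (fun n b => g n b) n) := by
    intro n
    induction n with
    | zero => exact ha
    | succ n ih => exact hg n _ ih
  exact ⟨fun n => Nat.rec (motive := fun _ => α) a (fun n b => g n b) n, key,
    fun n => hR n _ (key n)⟩

theorem iUnion_sdiff_succ {X : Type*} {f : ℕ → Set X} (hf : Antitone f) (h : ∀ x, ∃ k, x ∉ f k) :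
    ⋃ k, f k \ f (k + 1) = f 0 := by
  ext x
  simp only [Set.mem_iUnion, Set.mem_sdiff]
  refine ⟨fun ⟨k, hk, _⟩ => hf (Nat.zero_le k) hk, fun hx => ?_⟩
  by_contra! hcon
  obtain ⟨k, hk⟩ := h x
  refine hk ?_
  clear hk
  induction k with
  | zero => exact hx
  | succ k ih => exact hcon k ih

theorem pairwise_disjoint_sdiff_succ {X : Type*} {f : ℕ → Set X} (hf : Antitone f) :
    Pairwise (Function.onFun Disjoint fun k => f k \ f (k + 1)) := by
  have aux : ∀ i j, i < j → Disjoint (f i \ f (i + 1)) (f j \ f (j + 1)) :=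
    fun i j hij => Set.disjoint_left.2 fun w hw hw' => hw.2 (hf (Nat.succ_le_of_lt hij) hw'.1)
  intro i j hij
  rcases lt_or_gt_of_ne hij with h | h
  · exact aux i j h
  · exact (aux j i h).symm

/-- A stratification of a zero-dimensional space `X` by compact pieces `{lev ≤ m, N ≤ t}` for which
the graph of the lower semicontinuous function `N` behaves on every level like the graph of the
norm of complete Erdős space. -/
structure Stratification (X : Type*) [TopologicalSpace X] where
  N : X → ℝ
  lev : X → ℕ
  b : ℕ → Set X
  isClopen_b : ∀ n, IsClopen (b n)
  basis : ∀ x O, IsOpen O → x ∈ O → ∃ n, x ∈ b n ∧ b n ⊆ O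
  N_nonneg : ∀ x, 0 ≤ N x
  isClosed_N : ∀ t, IsClosed {x | N x ≤ t}
  isClosed_lev : ∀ m, IsClosed {x | lev x ≤ m}
  isCompact : ∀ m t, IsCompact {x | lev x ≤ m ∧ N x ≤ t}
  dense_same : ∀ x t δ O, N x < t → 0 < δ → IsOpen O → x ∈ O →
    ∃ x' ∈ O, lev x' = lev x ∧ |N x' - t| < δ
  dense_up : ∀ x δ O, 0 < δ → IsOpen O → x ∈ O →
    ∃ x' ∈ O, lev x < lev x' ∧ N x' < N x + δ
  base : ∃ x, lev x = 0 ∧ N x = 0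

namespace Stratification

variable {X : Type*} [TopologicalSpace X] (S : Stratification X)

include S in
theorem exists_clopen_separating {A B : Set X} (hA : IsClosed A) (hB : IsClosed B)
    (hAB : Disjoint A B) : ∃ C, IsClopen C ∧ A ⊆ C ∧ Disjoint C B := by
  classical
  let C : Set X := {x | ∃ n, x ∈ S.b n ∧ Disjoint (S.b n) B ∧
    ∀ j < n, x ∈ S.b j → ¬ Disjoint (S.b j) A}
  have hfin : ∀ (x : X) (n : ℕ), IsOpen (⋂ j ∈ {j | j < n ∧ x ∉ S.b j}, (S.b j)ᶜ) := by
    intro x n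
    refine Set.Finite.isOpen_biInter ((Set.finite_lt_nat n).subset fun j hj => hj.1) ?_
    intro j _
    exact (S.isClopen_b j).1.isOpen_compl
  have hmem : ∀ (x : X) (n : ℕ), x ∈ ⋂ j ∈ {j | j < n ∧ x ∉ S.b j}, (S.b j)ᶜ := by
    intro x n
    simp only [Set.mem_iInter]
    intro j hj
    exact hj.2
  refine ⟨C, ⟨?_, ?_⟩, ?_, ?_⟩
  · rw [← isOpen_compl_iff, isOpen_iff_forall_mem_open]
    intro x hx
    have hex : ∃ n, x ∈ S.b n ∧ (Disjoint (S.b n) A ∨ Disjoint (S.b n) B) := by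
      by_cases hxA : x ∈ A
      · obtain ⟨n, h1, h2⟩ := S.basis x Bᶜ hB.isOpen_compl
          (fun h => Set.disjoint_left.1 hAB hxA h)
        exact ⟨n, h1, Or.inr (Set.disjoint_left.2 fun z hz => h2 hz)⟩
      · obtain ⟨n, h1, h2⟩ := S.basis x Aᶜ hA.isOpen_compl hxA
        exact ⟨n, h1, Or.inl (Set.disjoint_left.2 fun z hz => h2 hz)⟩
    obtain ⟨hxn, hn⟩ := Nat.find_spec hex
    have hmin : ∀ j < Nat.find hex, x ∈ S.b j →
        ¬ Disjoint (S.b j) A ∧ ¬ Disjoint (S.b j) B := by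
      intro j hj hxj
      have := Nat.find_min hex hj
      tauto
    set n := Nat.find hex
    have hnB : ¬ Disjoint (S.b n) B := fun h => hx ⟨n, hxn, h, fun j hj hxj => (hmin j hj hxj).1⟩
    have hnA : Disjoint (S.b n) A := by tauto
    refine ⟨S.b n ∩ ⋂ j ∈ {j | j < n ∧ x ∉ S.b j}, (S.b j)ᶜ, ?_,
      (S.isClopen_b n).2.inter (hfin x n), hxn, hmem x n⟩
    rintro z ⟨hz, hz'⟩ ⟨k, hk, hkB, hkA⟩
    simp only [Set.mem_iInter] at hz'
    rcases lt_trichotomy n k with h | h | h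
    · exact hkA n h hz hnA
    · exact hnB (h ▸ hkB)
    · by_cases hxk : x ∈ S.b k
      · exact (hmin k h hxk).2 hkB
      · exact hz' k ⟨h, hxk⟩ hk
  · rw [isOpen_iff_forall_mem_open]
    rintro x ⟨n, hxn, hnB, hnA⟩
    refine ⟨S.b n ∩ ⋂ j ∈ {j | j < n ∧ x ∉ S.b j}, (S.b j)ᶜ, ?_,
      (S.isClopen_b n).2.inter (hfin x n), hxn, hmem x n⟩
    rintro z ⟨hz, hz'⟩
    simp only [Set.mem_iInter] at hz'
    refine ⟨n, hz, hnB, fun j hj hzj => ?_⟩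
    by_cases hxj : x ∈ S.b j
    · exact hnA j hj hxj
    · exact absurd hzj (hz' j ⟨hj, hxj⟩)
  · intro x hx
    obtain ⟨n, h1, h2⟩ := S.basis x Bᶜ hB.isOpen_compl (fun h => Set.disjoint_left.1 hAB hx h)
    exact ⟨n, h1, Set.disjoint_left.2 fun z hz => h2 hz,
      fun j _ hj h => Set.disjoint_left.1 h hj hx⟩
  · rw [Set.disjoint_left]
    rintro x ⟨n, h1, h2, _⟩ hx
    exact Set.disjoint_left.1 h2 h1 hx

include S in
theorem exists_clopen_nhd {x : X} {O : Set X} (hO : IsOpen O) (hx : x ∈ O) :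
    ∃ C, IsClopen C ∧ x ∈ C ∧ C ⊆ O := by
  obtain ⟨n, h1, h2⟩ := S.basis x O hO hx
  exact ⟨_, S.isClopen_b n, h1, h2⟩

/-- `x` is an `ε`-minimum of `N` on the clopen set `U`, and of minimal level there. -/
structure IsGood (ε : ℝ) (U : Set X) (x : X) : Prop where
  isClopen : IsClopen U
  mem : x ∈ U
  N_lt : ∀ z ∈ U, S.N x - ε < S.N z
  lev_le : ∀ z ∈ U, S.lev x ≤ S.lev z

variable {S} in
theorem IsGood.mono {ε : ℝ} {U U' : Set X} {x : X} (h : S.IsGood ε U x) (hU' : IsClopen U')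
    (hx : x ∈ U') (hsub : U' ⊆ U) : S.IsGood ε U' x :=
  ⟨hU', hx, fun z hz => h.N_lt z (hsub hz), fun z hz => h.lev_le z (hsub hz)⟩

theorem isOpen_lt_N (t : ℝ) : IsOpen {x | t < S.N x} := by
  have := (S.isClosed_N t).isOpen_compl
  simpa [Set.compl_ofPred] using this

theorem isOpen_le_lev (m : ℕ) : IsOpen {x | m ≤ S.lev x} := by
  cases m with
  | zero => simp
  | succ m =>
    have := (S.isClosed_lev m).isOpen_compl
    simpa [Set.compl_ofPred, Nat.succ_le_iff] using this

theorem exists_isGood_subset {x : X} {O : Set X} {ε : ℝ} (hε : 0 < ε) (hO : IsOpen O)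
    (hx : x ∈ O) : ∃ U ⊆ O, S.IsGood ε U x := by
  obtain ⟨n, h1, h2⟩ := S.basis x (O ∩ {z | S.N x - ε < S.N z} ∩ {z | S.lev x ≤ S.lev z})
    ((hO.inter (S.isOpen_lt_N _)).inter (S.isOpen_le_lev _)) ⟨⟨hx, by simp [hε]⟩, le_refl (S.lev x)⟩
  exact ⟨S.b n, fun z hz => (h2 hz).1.1, S.isClopen_b n, h1, fun z hz => (h2 hz).1.2,
    fun z hz => (h2 hz).2⟩

include S in
/-- A sequence of clopen sets escaping every member of a closed exhaustion `A`. -/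
theorem exists_chain [T1Space X] {A D : ℕ → Set X} {V : Set X} (hA : ∀ k, IsClosed (A k))
    (hcov : ∀ x, ∃ k, x ∈ A k) (hV : IsOpen V) (h0 : ∃ z ∈ V, z ∈ D 0)
    (hstep : ∀ k, ∀ z ∈ D k, ∀ O, IsOpen O → z ∈ O → ∃ z' ∈ O, z' ∈ D (k + 1) ∧ z' ∉ A k ∧ z' ≠ z) :
    ∃ (G : ℕ → Set X) (z : ℕ → X), (∀ k, IsClopen (G k)) ∧ (∀ k, G k ⊆ V) ∧
      (∀ k, z k ∈ G k ∧ z k ∈ D k) ∧ Pairwise (Function.onFun Disjoint G) ∧ IsClopen (⋃ k, G k) := by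
  obtain ⟨f, hf, hR⟩ := exists_dependent_seq (α := Set X × X)
    (P := fun k p => IsClopen p.1 ∧ p.1 ⊆ V ∧ p.2 ∈ p.1 ∧ p.2 ∈ D k)
    (R := fun k p q => q.1 ⊆ p.1 ∧ Disjoint q.1 (A k) ∧ p.2 ∉ q.1)
    (by
      obtain ⟨z, hz, hz0⟩ := h0
      obtain ⟨C, hC, hzC, hCV⟩ := S.exists_clopen_nhd hV hz
      exact ⟨(C, z), hC, hCV, hzC, hz0⟩)
    (by
      rintro k ⟨O, z⟩ ⟨hO, hOV, hz, hzD⟩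
      obtain ⟨z', hz'O, hz'D, hz'A, hne⟩ := hstep k z hzD O hO.2 hz
      obtain ⟨C, hC, hzC, hCO⟩ := S.exists_clopen_nhd
        (O := O ∩ (A k)ᶜ ∩ {z}ᶜ) ((hO.2.inter (hA k).isOpen_compl).inter
          isClosed_singleton.isOpen_compl) ⟨⟨hz'O, hz'A⟩, hne⟩
      exact ⟨(C, z'), ⟨hC, fun w hw => hOV (hCO hw).1.1, hzC, hz'D⟩, fun w hw => (hCO hw).1.1,
        Set.disjoint_left.2 fun w hw => (hCO hw).1.2, fun h => (hCO h).2 rfl⟩)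
  have hanti : Antitone fun k => (f k).1 := antitone_nat_of_succ_le fun k => (hR k).1
  have hunion : ⋃ k, (f k).1 \ (f (k + 1)).1 = (f 0).1 :=
    iUnion_sdiff_succ hanti fun x => by
      obtain ⟨k, hk⟩ := hcov x
      exact ⟨k + 1, fun h => Set.disjoint_left.1 (hR k).2.1 h hk⟩
  refine ⟨fun k => (f k).1 \ (f (k + 1)).1, fun k => (f k).2, fun k => (hf k).1.diff (hf _).1,
    fun k w hw => (hf k).2.1 hw.1, fun k => ⟨⟨(hf k).2.2.1, (hR k).2.2⟩, (hf k).2.2.2⟩,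
    pairwise_disjoint_sdiff_succ hanti, ?_⟩
  rw [hunion]
  exact (hf 0).1

theorem isClopen_iUnion_of_subset {ι : Type*} {G H : ι → Set X} (hG : ∀ i, IsOpen (G i))
    (hdisj : Pairwise (Function.onFun Disjoint G)) (hU : IsClopen (⋃ i, G i))
    (hH : ∀ i, IsClopen (H i)) (hsub : ∀ i, H i ⊆ G i) : IsClopen (⋃ i, H i) := by
  refine ⟨?_, isOpen_iUnion fun i => (hH i).2⟩
  have : (⋃ i, H i)ᶜ = (⋃ i, G i)ᶜ ∪ ⋃ i, (G i \ H i) := by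
    ext x
    simp only [Set.mem_compl_iff, Set.mem_iUnion, Set.mem_union, Set.mem_sdiff, not_exists]
    constructor
    · intro h
      by_cases hx : ∃ i, x ∈ G i
      · obtain ⟨i, hi⟩ := hx
        exact Or.inr ⟨i, hi, h i⟩
      · exact Or.inl (not_exists.1 hx)
    · rintro (h | ⟨i, hi, hi'⟩) j hj
      · exact h j (hsub j hj)
      · by_cases hij : i = j
        · exact hi' (hij ▸ hj)
        · exact Set.disjoint_left.1 (hdisj hij) hi (hsub j hj)
  rw [← isOpen_compl_iff, this]
  exact hU.1.isOpen_compl.union (isOpen_iUnion fun i => (hG i).sdiff (hH i).1)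

theorem _root_.exists_strictMono_lt {f : ℕ → ℝ} {c : ℝ} (hf : Tendsto f atTop atTop)
    (hc : ∀ k, c < f k) : ∃ u : ℕ → ℝ, StrictMono u ∧ Tendsto u atTop atTop ∧
      ∀ k, c < u k ∧ u k < f k := by
  have hmin : ∀ k, ∃ j, ∀ i, f (k + j) ≤ f (k + i) := by
    intro k
    have : Tendsto (fun i => f (k + i)) cofinite atTop := by
      rw [Nat.cofinite_eq_atTop]
      exact hf.comp (tendsto_atTop_mono (fun i => Nat.le_add_left i k) tendsto_id)
    exact this.exists_forall_le
  choose j hj using hmin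
  have hm0 : ∀ k, 0 < f (k + j k) - c := fun k => sub_pos.2 (hc _)
  have hm1 : ∀ k, f (k + j k) ≤ f (k + 1 + j (k + 1)) := fun k => by
    have := hj k (1 + j (k + 1))
    rwa [← add_assoc] at this
  have hpos : ∀ k : ℕ, (0 : ℝ) < 1 / (k + 2) := fun k => by positivity
  have hle : ∀ k : ℕ, (1 : ℝ) / (k + 2) ≤ 1 / 2 := fun k => by
    apply one_div_le_one_div_of_le <;> simp
  refine ⟨fun k => c + (f (k + j k) - c) * (1 - 1 / (k + 2)), ?_, ?_, fun k => ⟨?_, ?_⟩⟩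
  · refine strictMono_nat_of_lt_succ fun k => ?_
    have h1 : (1 : ℝ) / ((k + 1 : ℕ) + 2) < 1 / (k + 2) := by
      apply one_div_lt_one_div_of_lt
      · positivity
      · push_cast; linarith
    have h2 := hle k
    have : (f (k + j k) - c) * (1 - 1 / (k + 2)) <
        (f (k + 1 + j (k + 1)) - c) * (1 - 1 / ((k + 1 : ℕ) + 2)) := by
      apply mul_lt_mul' _ _ _ (hm0 (k + 1))
      · linarith [hm1 k]
      · linarith
      · linarith
    simpa using this
  · rw [tendsto_atTop]
    intro M
    obtain ⟨n, hn⟩ := eventually_atTop.1 (tendsto_atTop.1 hf (c + 2 * |M - c|))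
    filter_upwards [eventually_ge_atTop n] with k hk
    have h1 : c + 2 * |M - c| ≤ f (k + j k) := hn _ (by omega)
    have h2 := hle k
    have h3 : |M - c| ≤ (f (k + j k) - c) * (1 - 1 / (k + 2)) := by
      nlinarith [hm0 k]
    linarith [le_abs_self (M - c)]
  · have := mul_pos (hm0 k) (by linarith [hle k] : (0 : ℝ) < 1 - 1 / (k + 2))
    linarith
  · have := mul_pos (hm0 k) (hpos k)
    have h2 := hj k 0
    rw [add_zero] at h2
    nlinarith

theorem exists_new_level_chain [T1Space X] {V : Set X} (hV : IsOpen V) {y : X} (hy : y ∈ V)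
    {δ : ℝ} (hδ : 0 < δ) :
    ∃ (G : ℕ → Set X) (z : ℕ → X), (∀ k, IsClopen (G k)) ∧ (∀ k, G k ⊆ V) ∧ (∀ k, z k ∈ G k) ∧
      (∀ k, S.lev y < S.lev (z k) ∧ S.N (z k) < S.N y + δ) ∧
      Pairwise (Function.onFun Disjoint G) ∧ IsClopen (⋃ k, G k) ∧ ∀ k, y ∉ G k := by
  have hup : ∀ k : ℕ, ∀ x ∈ V, S.N x < S.N y + δ → ∀ O, IsOpen O → x ∈ O →
      ∃ x' ∈ O, S.lev x + k < S.lev x' ∧ S.N x' < S.N y + δ := by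
    intro k x _ hN O hO hxO
    induction k with
    | zero =>
      obtain ⟨x', h1, h2, h3⟩ := S.dense_up x (S.N y + δ - S.N x) O (by linarith) hO hxO
      exact ⟨x', h1, by simpa using h2, by linarith⟩
    | succ k ih =>
      obtain ⟨x', h1, h2, h3⟩ := ih
      obtain ⟨x'', h1', h2', h3'⟩ := S.dense_up x' (S.N y + δ - S.N x') O (by linarith) hO h1
      exact ⟨x'', h1', by omega, by linarith⟩
  have hV' : IsOpen (V ∩ {y}ᶜ) := hV.inter isClosed_singleton.isOpen_compl
  obtain ⟨G, z, h1, h2, h3, h4, h5⟩ := S.exists_chain (A := fun k => {x | S.lev x ≤ S.lev y + k})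
    (D := fun _ => {x | S.lev y < S.lev x ∧ S.N x < S.N y + δ ∧ x ∈ V}) (V := V ∩ {y}ᶜ)
    (fun k => S.isClosed_lev _) (fun x => ⟨S.lev x, by simp⟩) hV'
    (by
      obtain ⟨x', h1, h2, h3⟩ := hup 0 y hy (by linarith) V hV hy
      refine ⟨x', ⟨h1, ?_⟩, by simpa using h2, h3, h1⟩
      rintro rfl
      simp at h2)
    (by
      rintro k z ⟨hz1, hz2, hz3⟩ O hO hzO
      obtain ⟨x', h1, h2, h3⟩ := hup k z hz3 hz2 (O ∩ V) (hO.inter hV) ⟨hzO, hz3⟩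
      refine ⟨x', h1.1, ⟨by omega, h3, h1.2⟩, ?_, ?_⟩
      · simp only [Set.mem_ofPred_eq]
        omega
      · rintro rfl
        omega)
  exact ⟨G, z, h1, fun k x hx => (h2 k hx).1, fun k => (h3 k).1,
    fun k => ⟨(h3 k).2.1, (h3 k).2.2.1⟩, h4, h5, fun k hk => (h2 k hk).2 rfl⟩

theorem exists_same_level_chain [T1Space X] {V : Set X} (hV : IsOpen V) {y : X} (hy : y ∈ V)
    {f : ℕ → ℝ} (hf : Tendsto f atTop atTop) (hc : ∀ k, S.N y < f k) :
    ∃ (G : ℕ → Set X) (z : ℕ → X), (∀ k, IsClopen (G k)) ∧ (∀ k, G k ⊆ V) ∧ (∀ k, z k ∈ G k) ∧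
      (∀ k, S.lev (z k) = S.lev y ∧ S.N (z k) < f k) ∧
      Pairwise (Function.onFun Disjoint G) ∧ IsClopen (⋃ k, G k) ∧ ∀ k, y ∉ G k := by
  obtain ⟨u, hu, hu', huf⟩ := exists_strictMono_lt hf hc
  have hbetween : ∀ x a c O, S.N x ≤ a → a < c → IsOpen O → x ∈ O →
      ∃ x' ∈ O, S.lev x' = S.lev x ∧ a < S.N x' ∧ S.N x' < c := by
    intro x a c O h1 h2 hO hx
    obtain ⟨x', h3, h4, h5⟩ := S.dense_same x ((a + c) / 2) ((c - a) / 2) O (by linarith)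
      (by linarith) hO hx
    rw [abs_lt] at h5
    exact ⟨x', h3, h4, by linarith, by linarith⟩
  have hV' : IsOpen (V ∩ {y}ᶜ) := hV.inter isClosed_singleton.isOpen_compl
  obtain ⟨G, z, h1, h2, h3, h4, h5⟩ := S.exists_chain (A := fun k => {x | S.N x ≤ u k})
    (D := fun k => {x | S.lev x = S.lev y ∧ S.N x ≤ u k}) (V := V ∩ {y}ᶜ)
    (fun k => S.isClosed_N _)
    (fun x => (tendsto_atTop.1 hu' (S.N x)).exists) hV'
    (by
      obtain ⟨x', h1, h2, h3, h4⟩ := hbetween y (S.N y) (u 0) V le_rfl (huf 0).1 hV hy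
      refine ⟨x', ⟨h1, ?_⟩, h2, h4.le⟩
      rintro rfl
      exact lt_irrefl _ h3)
    (by
      rintro k z ⟨hz1, hz2⟩ O hO hzO
      obtain ⟨x', h1, h2, h3, h4⟩ := hbetween z (u k) (u (k + 1)) O hz2 (hu k.lt_succ_self) hO hzO
      refine ⟨x', h1, ⟨h2.trans hz1, h4.le⟩, ?_, ?_⟩
      · simpa using h3
      · rintro rfl
        linarith)
  exact ⟨G, z, h1, fun k x hx => (h2 k hx).1, fun k => (h3 k).1,
    fun k => ⟨(h3 k).2.1, (h3 k).2.2.trans_lt (huf k).2⟩, h4, h5, fun k hk => (h2 k hk).2 rfl⟩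

/-- Pairwise disjoint small clopen sets in `V` with prescribed values of `N` can be cut out of `V`,
either on the level of `y` or on some higher level. -/
theorem exists_insertion [T1Space X] {ι : Type*} [Countable ι] {s : Set ι} {same : ι → Prop}
    {t : ι → ℝ} {V : Set X} (hV : IsOpen V) {y : X} (hy : y ∈ V) {ε ε' : ℝ} (hε : 0 < ε) (hε' : 0 < ε')
    (ht : ∀ i ∈ s, S.N y - ε < t i)
    (hfin : ∀ T, {i | i ∈ s ∧ same i ∧ t i ≤ T}.Finite) :
    ∃ (H : ι → Set X) (w : ι → X), (∀ i ∈ s, S.IsGood ε' (H i) (w i)) ∧ (∀ i ∉ s, H i = ∅) ∧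
      (∀ i, H i ⊆ V) ∧ (∀ i ∈ s, S.lev y ≤ S.lev (w i) ∧ (S.lev (w i) = S.lev y ↔ same i)) ∧
      (∀ i ∈ s, |S.N (w i) - t i| < ε + ε') ∧
      Pairwise (Function.onFun Disjoint H) ∧ IsClopen (⋃ i, H i) ∧ ∀ i, y ∉ H i := by
  classical
  obtain ⟨e, he⟩ := exists_injective_nat ι
  obtain ⟨G, z, hG, hGV, hzG, hz, hGd, hGU, hyG⟩ := S.exists_new_level_chain hV hy hε'
  have hV' : IsOpen (V \ ⋃ k, G k) := hV.sdiff hGU.1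
  have hy' : y ∈ V \ ⋃ k, G k := ⟨hy, by simpa using hyG⟩
  let f : ℕ → ℝ := fun k => if h : ∃ i, e i = k ∧ i ∈ s ∧ same i then t h.choose + ε
    else S.N y + 1 + k
  have hfe : ∀ i ∈ s, same i → f (e i) = t i + ε := by
    intro i hi hs
    have h : ∃ i', e i' = e i ∧ i' ∈ s ∧ same i' := ⟨i, rfl, hi, hs⟩
    simp only [f, dif_pos h]
    rw [he h.choose_spec.1]
  have hc : ∀ k, S.N y < f k := by
    intro k
    by_cases h : ∃ i, e i = k ∧ i ∈ s ∧ same i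
    · obtain ⟨i, rfl, hi, hs⟩ := h
      rw [hfe i hi hs]
      linarith [ht i hi]
    · simp only [f, dif_neg h]
      linarith [k.cast_nonneg (α := ℝ)]
  have hf : Tendsto f atTop atTop := by
    rw [tendsto_atTop]
    intro M
    have h1 : ((e '' {i | i ∈ s ∧ same i ∧ t i ≤ M - ε})).Finite := (hfin _).image _
    have h2 := h1.eventually_cofinite_notMem
    rw [Nat.cofinite_eq_atTop] at h2
    have h3 := tendsto_atTop.1 (tendsto_natCast_atTop_atTop (R := ℝ)) (M - S.N y)
    filter_upwards [h2, h3] with k hk hk'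
    by_cases h : ∃ i, e i = k ∧ i ∈ s ∧ same i
    · obtain ⟨i, rfl, hi, hs⟩ := h
      rw [hfe i hi hs]
      by_contra! hlt
      exact hk ⟨i, ⟨hi, hs, by linarith⟩, rfl⟩
    · simp only [f, dif_neg h]
      linarith
  obtain ⟨G', z', hG', hGV', hzG', hz', hGd', hGU', hyG'⟩ := S.exists_same_level_chain hV' hy' hf hc
  let K : ι → Set X := fun i => if same i then G' (e i) else G (e i)
  have hGG' : ∀ i j, Disjoint (G i) (G' j) := fun i j => Set.disjoint_left.2 fun x hx hx' =>
    (hGV' j hx').2 (Set.mem_iUnion.2 ⟨i, hx⟩)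
  have hchoice : ∀ i ∈ s, ∃ H w, S.IsGood ε' H w ∧ H ⊆ K i ∧ S.lev y ≤ S.lev w ∧
      (S.lev w = S.lev y ↔ same i) ∧ |S.N w - t i| < ε + ε' := by
    intro i hi
    have key : ∀ x O, IsOpen O → x ∈ O → S.N x < t i + ε + ε' →
        ∃ H w, S.IsGood ε' H w ∧ H ⊆ O ∧ S.lev w = S.lev x ∧ |S.N w - t i| < ε + ε' := by
      intro x O hO hx hlt
      have hm : max (S.N x) (t i) < t i + ε + ε' := max_lt hlt (by linarith)
      have hm1 := le_max_left (S.N x) (t i)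
      have hm2 := le_max_right (S.N x) (t i)
      obtain ⟨w, hwO, hw1, hw2⟩ := S.dense_same x
        ((max (S.N x) (t i) + (t i + ε + ε')) / 2) ((t i + ε + ε' - max (S.N x) (t i)) / 2) O
        (by linarith) (by linarith) hO hx
      obtain ⟨H, hHO, hH⟩ := S.exists_isGood_subset hε' hO hwO
      refine ⟨H, w, hH, hHO, hw1, ?_⟩
      rw [abs_lt] at hw2 ⊢
      constructor <;> linarith
    by_cases hs : same i
    · obtain ⟨H, w, h1, h2, h3, h4⟩ := key (z' (e i)) (G' (e i)) (hG' _).2 (hzG' _) (by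
        have := (hz' (e i)).2
        rw [hfe i hi hs] at this
        linarith)
      have h5 := (hz' (e i)).1
      exact ⟨H, w, h1, by simpa [K, hs] using h2, by omega, by simp [hs, h3, h5], h4⟩
    · obtain ⟨H, w, h1, h2, h3, h4⟩ := key (z (e i)) (G (e i)) (hG _).2 (hzG _) (by
        linarith [(hz (e i)).2, ht i hi])
      have h5 := (hz (e i)).1
      refine ⟨H, w, h1, by simpa [K, hs] using h2, by omega, ?_, h4⟩
      simp only [hs, iff_false]
      omega
  have : Nonempty X := ⟨y⟩
  choose! H₀ w hgood hsub hlev hsame habs using hchoice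
  let H : ι → Set X := fun i => if i ∈ s then H₀ i else ∅
  have hHs : ∀ i ∈ s, H i = H₀ i := fun i hi => if_pos hi
  have hHn : ∀ i ∉ s, H i = ∅ := fun i hi => if_neg hi
  have hHK : ∀ i, H i ⊆ K i := fun i => by
    by_cases hi : i ∈ s
    · rw [hHs i hi]
      exact hsub i hi
    · simp [hHn i hi]
  have hHc : ∀ i, IsClopen (H i) := fun i => by
    by_cases hi : i ∈ s
    · rw [hHs i hi]
      exact (hgood i hi).isClopen
    · rw [hHn i hi]
      exact isClopen_empty
  have hKd : Pairwise (Function.onFun Disjoint K) := by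
    intro i j hij
    have hne := he.ne hij
    simp only [Function.onFun, K]
    split_ifs
    · exact hGd' hne
    · exact (hGG' _ _).symm
    · exact hGG' _ _
    · exact hGd hne
  have hcomp : ∀ G₀ : ℕ → Set X, (∀ k, IsClopen (G₀ k)) → Pairwise (Function.onFun Disjoint G₀) →
      IsClopen (⋃ k, G₀ k) → IsClopen (⋃ i, G₀ (e i)) := by
    intro G₀ h1 h2 h3
    have := isClopen_iUnion_of_subset (H := fun k => if k ∈ Set.range e then G₀ k else ∅)
      (fun k => (h1 k).2) h2 h3 (fun k => by
        split_ifs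
        · exact h1 k
        · exact isClopen_empty) (fun k => by
        split_ifs <;> simp)
    convert this using 1
    ext x
    simp only [Set.mem_iUnion]
    constructor
    · rintro ⟨i, hi⟩
      exact ⟨e i, by simpa using hi⟩
    · rintro ⟨k, hk⟩
      split_ifs at hk with h
      · obtain ⟨i, rfl⟩ := h
        exact ⟨i, hk⟩
      · exact hk.elim
  have hpart : ∀ (G₀ : ℕ → Set X) (p : ι → Prop) [DecidablePred p], (∀ k, IsClopen (G₀ k)) →
      Pairwise (Function.onFun Disjoint G₀) → IsClopen (⋃ k, G₀ k) →
      (∀ i, p i → H i ⊆ G₀ (e i)) → IsClopen (⋃ i, if p i then H i else ∅) := by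
    intro G₀ p _ h1 h2 h3 h4
    refine isClopen_iUnion_of_subset (G := fun i => G₀ (e i)) (fun i => (h1 _).2)
      (fun i j hij => h2 (he.ne hij)) (hcomp G₀ h1 h2 h3) (fun i => ?_) (fun i => ?_)
    · split_ifs
      · exact hHc i
      · exact isClopen_empty
    · split_ifs with h
      · exact h4 i h
      · simp
  have hunion : (⋃ i, H i) = (⋃ i, if same i then H i else ∅) ∪ ⋃ i, if ¬ same i then H i else ∅ := by
    rw [← Set.iUnion_union_distrib]
    refine Set.iUnion_congr fun i => ?_
    by_cases h : same i <;> simp [h]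
  have hKV : ∀ i, K i ⊆ V ∧ y ∉ K i := fun i => by
    simp only [K]
    split_ifs
    · exact ⟨(hGV' _).trans Set.sdiff_subset, hyG' _⟩
    · exact ⟨hGV _, hyG _⟩
  refine ⟨H, w, fun i hi => ?_, hHn, fun i => (hHK i).trans (hKV i).1,
    fun i hi => ⟨hlev i hi, hsame i hi⟩, habs,
    fun i j hij => (hKd hij).mono (hHK i) (hHK j), ?_, fun i hi => (hKV i).2 (hHK i hi)⟩
  · rw [hHs i hi]
    exact hgood i hi
  · rw [hunion]
    refine (hpart G' same hG' hGd' hGU' fun i h => ?_).union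
      (hpart G (fun i => ¬ same i) hG hGd hGU fun i h => ?_)
    · simpa [K, h] using hHK i
    · simpa [K, h] using hHK i

theorem lowerSemicontinuous_N : LowerSemicontinuous S.N :=
  lowerSemicontinuous_iff_isClosed_preimage.2 S.isClosed_N

theorem exists_isGood_sdiff {R : Set X} (hR : IsClopen R) {ε : ℝ} (hε : 0 < ε) {l : ℕ}
    (hl : ∀ x ∈ R, l ≤ S.lev x) : ∃ R' ⊆ R, IsClopen R' ∧ (∀ x ∈ R', l + 1 ≤ S.lev x) ∧
      ((R \ R').Nonempty → ∃ c, S.IsGood ε (R \ R') c) := by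
  by_cases hne : ∃ x ∈ R, S.lev x ≤ l
  · obtain ⟨x₀, hx₀, hx₀l⟩ := hne
    obtain ⟨x, ⟨hxR, hxl, hxN⟩, hmin⟩ :=
      (S.lowerSemicontinuous_N.lowerSemicontinuousOn _).exists_isMinOn
      (s := R ∩ {x | S.lev x ≤ l ∧ S.N x ≤ S.N x₀}) ⟨x₀, hx₀, hx₀l, le_rfl⟩
      ((S.isCompact l (S.N x₀)).inter_left hR.1)
    have hmin' : ∀ z ∈ R, S.lev z ≤ l → S.N x ≤ S.N z := by
      intro z hz hzl
      rcases le_total (S.N z) (S.N x₀) with h | h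
      · exact hmin ⟨hz, hzl, h⟩
      · exact le_trans hxN h
    obtain ⟨C, hC, hAC, hCB⟩ := S.exists_clopen_separating (hR.1.inter (S.isClosed_lev l))
      (S.isClosed_N (S.N x - ε)) (Set.disjoint_left.2 fun z hz hz' => by
        have h1 := hmin' z hz.1 hz.2
        have h2 : S.N z ≤ S.N x - ε := hz'
        linarith)
    refine ⟨R \ C, Set.sdiff_subset, hR.diff hC, fun z hz => ?_, fun _ => ⟨x, ?_⟩⟩
    · by_contra! hlt
      exact hz.2 (hAC ⟨hz.1, Nat.lt_succ_iff.1 hlt⟩)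
    · rw [Set.sdiff_sdiff_right_self]
      refine ⟨hR.inter hC, ⟨hxR, hAC ⟨hxR, hxl⟩⟩, fun z hz => ?_,
        fun z hz => le_trans hxl (hl z hz.1)⟩
      by_contra! hlt
      exact Set.disjoint_left.1 hCB hz.2 hlt
  · push Not at hne
    exact ⟨R, subset_rfl, hR, hne, by simp⟩

theorem exists_isGood_partition {R : Set X} (hR : IsClopen R) {ε : ℝ} (hε : 0 < ε) :
    ∃ (G : ℕ → Set X) (c : ℕ → X), (∀ k, IsClopen (G k)) ∧
      (∀ k, (G k).Nonempty → S.IsGood ε (G k) (c k)) ∧ Pairwise (Function.onFun Disjoint G) ∧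
      ⋃ k, G k = R := by
  obtain ⟨f, hf, hR'⟩ := exists_dependent_seq
    (P := fun l R' => IsClopen R' ∧ (l = 0 → R' = R) ∧ ∀ x ∈ R', l ≤ S.lev x)
    (R := fun _ R' R'' => R'' ⊆ R' ∧ ((R' \ R'').Nonempty → ∃ c, S.IsGood ε (R' \ R'') c))
    ⟨R, hR, by simp⟩ (by
      rintro l R' ⟨h1, -, h2⟩
      obtain ⟨R'', h3, h4, h5, h6⟩ := S.exists_isGood_sdiff h1 hε h2
      exact ⟨R'', ⟨h4, by simp, h5⟩, h3, h6⟩)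
  have hanti : Antitone f := antitone_nat_of_succ_le fun k => (hR' k).1
  have : Nonempty X := let ⟨x, _⟩ := S.base; ⟨x⟩
  choose! c hc using fun k => (hR' k).2
  refine ⟨fun k => f k \ f (k + 1), c, fun k => (hf k).1.diff (hf _).1, hc,
    pairwise_disjoint_sdiff_succ hanti, ?_⟩
  rw [iUnion_sdiff_succ hanti fun x => ⟨S.lev x + 1, fun h => by
    have := (hf _).2.2 x h
    omega⟩, (hf 0).2.1 rfl]

/-- Membership in `b` is constant on `U`. -/
def _root_.Set.Decides {X : Type*} (b U : Set X) : Prop := U ⊆ b ∨ U ⊆ bᶜ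

theorem _root_.Set.Decides.mono {X : Type*} {b U U' : Set X} (h : b.Decides U) (hU : U' ⊆ U) :
    b.Decides U' :=
  h.imp hU.trans hU.trans

theorem exists_split {U : Set X} {x : X} {ε : ℝ} (hU : S.IsGood ε U x) {b : Set X}
    (hb : IsClopen b) {ε' : ℝ} (hε' : 0 < ε') :
    ∃ (U₀ : Set X) (G : Bool × ℕ → Set X) (c : Bool × ℕ → X), U₀ ⊆ U ∧ S.IsGood ε' U₀ x ∧
      b.Decides U₀ ∧ (∀ i, IsClopen (G i)) ∧ (∀ i, (G i).Nonempty → S.IsGood ε' (G i) (c i)) ∧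
      (∀ i, b.Decides (G i)) ∧ Pairwise (Function.onFun Disjoint G) ∧ ⋃ i, G i = U \ U₀ ∧
      ∀ m t, {i | (G i).Nonempty ∧ S.lev (c i) ≤ m ∧ S.N (c i) ≤ t}.Finite := by
  obtain ⟨O, hO, hxO, hOb⟩ : ∃ O, IsOpen O ∧ x ∈ O ∧ b.Decides O := by
    by_cases hx : x ∈ b
    · exact ⟨b, hb.2, hx, Or.inl subset_rfl⟩
    · exact ⟨bᶜ, hb.1.isOpen_compl, hx, Or.inr subset_rfl⟩
  obtain ⟨U₀, hU₀, hgood⟩ := S.exists_isGood_subset hε' (hO.inter hU.isClopen.2) ⟨hxO, hU.mem⟩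
  let B : Bool → Set X := fun i => if i then b else bᶜ
  have hB : ∀ i, IsClopen (B i) := by
    rintro (_ | _)
    · simpa [B] using hb
    · simpa [B] using hb
  have hR : IsClopen (U \ U₀) := hU.isClopen.diff hgood.isClopen
  have hpart := fun i => S.exists_isGood_partition (hR.inter (hB i)) hε'
  choose G c h1 h2 h3 h4 using hpart
  have hGB : ∀ i k, G i k ⊆ B i := fun i k z hz =>
    ((h4 i).subset (Set.mem_iUnion.2 ⟨k, hz⟩)).2
  have hdisj : Pairwise (Function.onFun Disjoint fun i : Bool × ℕ => G i.1 i.2) := by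
    rintro ⟨i, k⟩ ⟨j, l⟩ hne
    by_cases hij : i = j
    · subst hij
      exact h3 i (fun h => hne (congrArg (Prod.mk i) h))
    · refine Disjoint.mono (hGB i k) (hGB j l) ?_
      rcases i with _ | _ <;> rcases j with _ | _ <;>
        simp_all [B, disjoint_compl_left, disjoint_compl_right]
  have hunion : ⋃ i : Bool × ℕ, G i.1 i.2 = U \ U₀ := by
    rw [Set.iUnion_prod']
    change ⨆ i, ⋃ k, G i k = _
    rw [iSup_bool_eq, h4, h4]
    change U \ U₀ ∩ B true ∪ U \ U₀ ∩ B false = _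
    rw [← Set.inter_union_distrib_left]
    simp [B]
  refine ⟨U₀, fun i => G i.1 i.2, fun i => c i.1 i.2, fun z hz => (hU₀ hz).2, hgood,
    hOb.mono fun z hz => (hU₀ hz).1, fun i => h1 _ _, fun i => h2 _ _, fun i => ?_, hdisj, hunion,
    fun m t => ?_⟩
  · rcases i with ⟨_ | _, k⟩
    · exact Or.inr (by simpa [B] using hGB false k)
    · exact Or.inl (by simpa [B] using hGB true k)
  · obtain ⟨F, hF⟩ := ((S.isCompact m t).inter_right hR.1).elim_finite_subcover
      (fun i : Bool × ℕ => G i.1 i.2) (fun i => (h1 _ _).2) (by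
        rw [hunion]
        exact Set.inter_subset_right)
    refine F.finite_toSet.subset ?_
    rintro i ⟨hi1, hi2, hi3⟩
    have hmem := (h2 _ _ hi1).mem
    obtain ⟨j, hj⟩ := Set.mem_iUnion.1 (hF ⟨⟨hi2, hi3⟩,
      hunion.subset (Set.mem_iUnion.2 ⟨i, hmem⟩)⟩)
    obtain ⟨hjF, hj⟩ := Set.mem_iUnion.1 hj
    have : i = j := by
      by_contra hne
      exact Set.disjoint_left.1 (hdisj hne) hmem hj
    exact this ▸ hjF

variable {Y : Type*} [TopologicalSpace Y] (T : Stratification Y)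

theorem exists_transfer [T1Space Y] {ι : Type*} [Countable ι] {U : Set X} {x : X} {ε ε' : ℝ}
    (hε : 0 < ε) (hε' : 0 < ε') (hU : S.IsGood ε U x) {G : ι → Set X} {c : ι → X}
    (hG : ∀ i, (G i).Nonempty → S.IsGood ε' (G i) (c i)) (hGU : ∀ i, G i ⊆ U)
    (hfin : ∀ m t, {i | (G i).Nonempty ∧ S.lev (c i) ≤ m ∧ S.N (c i) ≤ t}.Finite)
    {V : Set Y} {y : Y} (hV : IsOpen V) (hy : y ∈ V) :
    ∃ (H : ι → Set Y) (w : ι → Y), (∀ i, (G i).Nonempty → T.IsGood ε' (H i) (w i)) ∧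
      (∀ i, (H i).Nonempty → (G i).Nonempty) ∧ (∀ i, H i ⊆ V) ∧
      (∀ i, (G i).Nonempty → (T.lev (w i) = T.lev y ↔ S.lev (c i) = S.lev x)) ∧
      (∀ i, (G i).Nonempty → |(T.N (w i) - S.N (c i)) - (T.N y - S.N x)| < ε + ε') ∧
      Pairwise (Function.onFun Disjoint H) ∧ IsClopen (⋃ i, H i) ∧ ∀ i, y ∉ H i := by
  obtain ⟨H, w, h1, h2, h3, h4, h5, h6, h7, h8⟩ := T.exists_insertion (ι := ι)
    (s := {i | (G i).Nonempty}) (same := fun i => S.lev (c i) = S.lev x)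
    (t := fun i => S.N (c i) + (T.N y - S.N x)) hV hy hε hε'
    (fun i hi => by
      have := hU.N_lt _ (hGU i (hG i hi).mem)
      linarith)
    (fun t => (hfin (S.lev x) (t - (T.N y - S.N x))).subset fun i hi =>
      ⟨hi.1, hi.2.1.le, by linarith [hi.2.2]⟩)
  refine ⟨H, w, h1, fun i hi => ?_, h3, fun i hi => (h4 i hi).2, fun i hi => ?_, h6, h7, h8⟩
  · by_contra hcon
    rw [h2 i hcon] at hi
    exact Set.not_nonempty_empty hi
  · rw [sub_sub]
    exact h5 i hi

/-- A clopen set with a chosen point in each of two spaces. -/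
structure _root_.MarkedPair (X Y : Type*) where
  U : Set X
  x : X
  V : Set Y
  y : Y

/-- The two halves of a marked pair, interchanged. -/
def _root_.MarkedPair.swap {X Y : Type*} (p : MarkedPair X Y) : MarkedPair Y X :=
  ⟨p.V, p.y, p.U, p.x⟩

/-- Both halves of a marked pair are good. -/
def GoodPair (ε : ℝ) (p : MarkedPair X Y) : Prop := S.IsGood ε p.U p.x ∧ T.IsGood ε p.V p.y

/-- The difference between the values of `N` at the two marked points. -/
def offset (p : MarkedPair X Y) : ℝ := T.N p.y - S.N p.x

/-- The conditions on a piece `q` of a decomposition of the marked pair `p`. -/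
structure Refines (b : Set X) (b' : Set Y) (δ : ℝ) (p q : MarkedPair X Y) : Prop where
  U_subset : q.U ⊆ p.U
  V_subset : q.V ⊆ p.V
  decides_U : b.Decides q.U
  decides_V : b'.Decides q.V
  lev_eq_iff : S.lev q.x = S.lev p.x ↔ T.lev q.y = T.lev p.y
  abs_offset_sub_lt : |S.offset T q - S.offset T p| < δ

theorem _root_.existsUnique_option_sum {I J α : Type*} {U U₀ : Set α} {G : I → Set α}
    {H : J → Set α} (hU₀ : U₀ ⊆ U) (hG : Pairwise (Function.onFun Disjoint G))
    (hH : Pairwise (Function.onFun Disjoint H)) (hGU : ⋃ i, G i = U \ U₀) (hHU : ∀ j, H j ⊆ U₀)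
    {z : α} : z ∈ U ↔ ∃! k : Option (I ⊕ J), z ∈ k.elim (U₀ \ ⋃ j, H j) (Sum.elim G H) := by
  have hGz : ∀ i, z ∈ G i → z ∈ U ∧ z ∉ U₀ := fun i hi => hGU.subset (Set.mem_iUnion.2 ⟨i, hi⟩)
  constructor
  · intro hz
    by_cases hz₀ : z ∈ U₀
    · by_cases hzH : ∃ j, z ∈ H j
      · obtain ⟨j, hj⟩ := hzH
        refine ⟨some (Sum.inr j), hj, ?_⟩
        rintro (_ | i | j') h
        · exact absurd (Set.mem_iUnion.2 ⟨j, hj⟩) h.2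
        · exact absurd hz₀ (hGz i h).2
        · by_contra hne
          exact Set.disjoint_left.1 (hH fun h' => hne (by rw [h'])) h hj
      · refine ⟨none, ⟨hz₀, by simpa using hzH⟩, ?_⟩
        rintro (_ | i | j') h
        · rfl
        · exact absurd hz₀ (hGz i h).2
        · exact absurd ⟨j', h⟩ hzH
    · obtain ⟨i, hi⟩ := Set.mem_iUnion.1 (hGU.superset ⟨hz, hz₀⟩)
      refine ⟨some (Sum.inl i), hi, ?_⟩
      rintro (_ | i' | j') h
      · exact absurd h.1 hz₀
      · by_contra hne
        exact Set.disjoint_left.1 (hG fun h' => hne (by rw [h'])) h hi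
      · exact absurd (hHU j' h) hz₀
  · rintro ⟨_ | i | j, h, -⟩
    · exact hU₀ h.1
    · exact (hGz i h).1
    · exact hU₀ (hHU j h)

theorem _root_.existsUnique_mem_range {κ α β : Type*} {Q : κ → β} {W : β → Set α} {P : β → Prop}
    {z : α} (hP : ∀ k, (W (Q k)).Nonempty → P (Q k)) (h : ∃! k, z ∈ W (Q k)) :
    ∃! q, q ∈ {q | ∃ k, q = Q k ∧ P q} ∧ z ∈ W q := by
  obtain ⟨k, hk, huniq⟩ := h
  refine ⟨Q k, ⟨⟨k, rfl, hP k ⟨z, hk⟩⟩, hk⟩, ?_⟩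
  rintro _ ⟨⟨l, rfl, -⟩, hl⟩
  rw [huniq l hl]

theorem exists_refinement [T1Space X] [T1Space Y] {p : MarkedPair X Y} {ε ε' : ℝ} (hε : 0 < ε)
    (hε' : 0 < ε') (hp : S.GoodPair T ε p) {b : Set X} {b' : Set Y} (hb : IsClopen b)
    (hb' : IsClopen b') :
    ∃ 𝒬 : Set (MarkedPair X Y), (∀ q ∈ 𝒬, S.GoodPair T ε' q ∧ S.Refines T b b' (ε + ε') p q) ∧
      (∀ z ∈ p.U, ∃! q, q ∈ 𝒬 ∧ z ∈ q.U) ∧ ∀ z ∈ p.V, ∃! q, q ∈ 𝒬 ∧ z ∈ q.V := by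
  obtain ⟨U₀, G, c, hU1, hU2, hU3, hG1, hG2, hG3, hG4, hG5, hG6⟩ := S.exists_split hp.1 hb hε'
  obtain ⟨V₀, G', c', hV1, hV2, hV3, hG1', hG2', hG3', hG4', hG5', hG6'⟩ :=
    T.exists_split hp.2 hb' hε'
  have hGU : ∀ i, G i ⊆ p.U := fun i z hz => (hG5.subset (Set.mem_iUnion.2 ⟨i, hz⟩)).1
  have hGV : ∀ i, G' i ⊆ p.V := fun i z hz => (hG5'.subset (Set.mem_iUnion.2 ⟨i, hz⟩)).1
  obtain ⟨H, w, hH1, hH2, hH3, hH4, hH5, hH6, hH7, hH8⟩ :=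
    S.exists_transfer T hε hε' hp.1 hG2 hGU hG6 hV2.isClopen.2 hV2.mem
  obtain ⟨H', w', hH1', hH2', hH3', hH4', hH5', hH6', hH7', hH8'⟩ :=
    T.exists_transfer S hε hε' hp.2 hG2' hGV hG6' hU2.isClopen.2 hU2.mem
  let Q : Option ((Bool × ℕ) ⊕ (Bool × ℕ)) → MarkedPair X Y := fun k =>
    ⟨k.elim (U₀ \ ⋃ j, H' j) (Sum.elim G H'), k.elim p.x (Sum.elim c w'),
      k.elim (V₀ \ ⋃ i, H i) (Sum.elim H G'), k.elim p.y (Sum.elim w c')⟩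
  have hne : ∀ k, (Q k).V.Nonempty → (Q k).U.Nonempty := by
    rintro (_ | i | j) h
    · exact ⟨p.x, hU2.mem, by simpa using hH8'⟩
    · exact hH2 i h
    · exact ⟨_, (hH1' j h).mem⟩
  have hU : ∀ z ∈ p.U, ∃! k, z ∈ (Q k).U := fun z hz =>
    (existsUnique_option_sum hU1 hG4 hH6' hG5 hH3').1 hz
  have hV : ∀ z ∈ p.V, ∃! k, z ∈ (Q k).V := fun z hz => by
    have := (existsUnique_option_sum hV1 hG4' hH6 hG5' hH3).1 hz
    refine ((Equiv.optionCongr (Equiv.sumComm _ _)).existsUnique_congr ?_).1 this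
    rintro (_ | i | j) <;> rfl
  refine ⟨{q | ∃ k, q = Q k ∧ q.U.Nonempty}, ?_, fun z hz => ?_, fun z hz => ?_⟩
  · rintro _ ⟨_ | i | j, rfl, h⟩
    · exact ⟨⟨hU2.mono (hU2.isClopen.diff hH7') ⟨hU2.mem, by simpa using hH8'⟩ Set.sdiff_subset,
        hV2.mono (hV2.isClopen.diff hH7) ⟨hV2.mem, by simpa using hH8⟩ Set.sdiff_subset⟩,
        Set.sdiff_subset.trans hU1, Set.sdiff_subset.trans hV1, hU3.mono Set.sdiff_subset,
        hV3.mono Set.sdiff_subset, by simp [Q], by simpa [Q, offset] using add_pos hε hε'⟩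
    · exact ⟨⟨hG2 i h, hH1 i h⟩, hGU i, (hH3 i).trans hV1, hG3 i, hV3.mono (hH3 i),
        (hH4 i h).symm, hH5 i h⟩
    · have h' := hH2' j h
      refine ⟨⟨hH1' j h', hG2' j h'⟩, (hH3' j).trans hU1, hGV j, hU3.mono (hH3' j), hG3' j,
        hH4' j h', ?_⟩
      have := hH5' j h'
      rw [← abs_neg] at this
      convert this using 2
      simp only [offset, Q, Option.elim, Sum.elim_inr]
      ring
  · exact existsUnique_mem_range (W := MarkedPair.U) (fun k h => h) (hU z hz)
  · exact existsUnique_mem_range (W := MarkedPair.V) hne (hV z hz)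

/-- A branch of the tree with root `p₀` in which the children of `p` at height `n` are `𝓡 n p`. -/
def _root_.IsBranch {β : Type*} (𝓡 : ℕ → β → Set β) (p₀ : β) (f : ℕ → β) : Prop :=
  f 0 = p₀ ∧ ∀ n, f (n + 1) ∈ 𝓡 n (f n)

theorem _root_.exists_isBranch {α β : Type*} {𝓡 : ℕ → β → Set β} {p₀ : β} {P : ℕ → β → Prop}
    {W : β → Set α} (h0 : P 0 p₀) (hP : ∀ n p, P n p → ∀ q ∈ 𝓡 n p, P (n + 1) q)
    (hex : ∀ n p, P n p → ∀ z ∈ W p, ∃! q, q ∈ 𝓡 n p ∧ z ∈ W q) {z : α} (hz : z ∈ W p₀) :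
    ∃ f, IsBranch 𝓡 p₀ f ∧ ∀ n, z ∈ W (f n) := by
  obtain ⟨f, hf, hR⟩ := exists_dependent_seq
    (P := fun n p => P n p ∧ z ∈ W p ∧ (n = 0 → p = p₀)) (R := fun n p q => q ∈ 𝓡 n p)
    ⟨p₀, h0, hz, fun _ => rfl⟩ (by
      rintro n p ⟨hp, hzp, -⟩
      obtain ⟨q, ⟨hq, hzq⟩, -⟩ := hex n p hp z hzp
      exact ⟨q, ⟨hP n p hp q hq, hzq, by simp⟩, hq⟩)
  exact ⟨f, ⟨(hf 0).2.2 rfl, hR⟩, fun n => (hf n).2.1⟩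

theorem _root_.IsBranch.induction {β : Type*} {𝓡 : ℕ → β → Set β} {p₀ : β} {P : ℕ → β → Prop}
    {f : ℕ → β} (hf : IsBranch 𝓡 p₀ f) (h0 : P 0 p₀)
    (hP : ∀ n p, P n p → ∀ q ∈ 𝓡 n p, P (n + 1) q) (n : ℕ) : P n (f n) := by
  induction n with
  | zero => exact hf.1 ▸ h0
  | succ n ih => exact hP n _ ih _ (hf.2 n)

theorem _root_.IsBranch.eq_of_mem {α β : Type*} {𝓡 : ℕ → β → Set β} {p₀ : β} {P : ℕ → β → Prop}
    {W : β → Set α} (h0 : P 0 p₀) (hP : ∀ n p, P n p → ∀ q ∈ 𝓡 n p, P (n + 1) q)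
    (hex : ∀ n p, P n p → ∀ z ∈ W p, ∃! q, q ∈ 𝓡 n p ∧ z ∈ W q)
    (hsub : ∀ n p, P n p → ∀ q ∈ 𝓡 n p, W q ⊆ W p) {f g : ℕ → β} (hf : IsBranch 𝓡 p₀ f)
    (hg : IsBranch 𝓡 p₀ g) {z : α} {n : ℕ} (hzf : z ∈ W (f n)) (hzg : z ∈ W (g n)) :
    f n = g n := by
  induction n with
  | zero => rw [hf.1, hg.1]
  | succ n ih =>
    have h1 := hf.induction h0 hP n
    have h2 := hg.induction h0 hP n
    have h3 := hsub n _ h1 _ (hf.2 n) hzf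
    have h4 := ih h3 (hsub n _ h2 _ (hg.2 n) hzg)
    exact (hex n _ h1 z h3).unique ⟨hf.2 n, hzf⟩ ⟨h4 ▸ hg.2 n, hzg⟩

/-- A decreasing sequence of good marked pairs. -/
structure IsChain (f : ℕ → MarkedPair X Y) : Prop where
  good : ∀ n, S.GoodPair T ((1 / 2) ^ n) (f n)
  refines : ∀ n, S.Refines T (S.b n) (T.b n) ((1 / 2) ^ n + (1 / 2) ^ (n + 1)) (f n) (f (n + 1))

namespace IsChain

variable {S T} {f : ℕ → MarkedPair X Y}

theorem swap (hf : S.IsChain T f) : T.IsChain S fun n => (f n).swap := by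
  refine ⟨fun n => ⟨(hf.good n).2, (hf.good n).1⟩, fun n => ?_⟩
  obtain ⟨h1, h2, h3, h4, h5, h6⟩ := hf.refines n
  refine ⟨h2, h1, h4, h3, h5.symm, ?_⟩
  rw [← abs_neg] at h6
  convert h6 using 2
  simp only [offset, MarkedPair.swap]
  ring

theorem antitone_U (hf : S.IsChain T f) : Antitone fun n => (f n).U :=
  antitone_nat_of_succ_le fun n => (hf.refines n).U_subset

theorem antitone_V (hf : S.IsChain T f) : Antitone fun n => (f n).V :=
  antitone_nat_of_succ_le fun n => (hf.refines n).V_subset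

theorem exists_U_subset (hf : S.IsChain T f) {x : X} (hx : ∀ n, x ∈ (f n).U) {O : Set X}
    (hO : IsOpen O) (hxO : x ∈ O) : ∃ n, (f n).U ⊆ O := by
  obtain ⟨m, hm, hmO⟩ := S.basis x O hO hxO
  refine ⟨m + 1, ?_⟩
  rcases (hf.refines m).decides_U with h | h
  · exact h.trans hmO
  · exact absurd hm (h (hx _))

theorem eq_of_mem_U [T1Space X] (hf : S.IsChain T f) {x x' : X} (hx : ∀ n, x ∈ (f n).U)
    (hx' : ∀ n, x' ∈ (f n).U) : x = x' := by
  by_contra hne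
  obtain ⟨n, hn⟩ := hf.exists_U_subset hx (isClosed_singleton (x := x')).isOpen_compl hne
  exact hn (hx' n) rfl

theorem tendsto_N (hf : S.IsChain T f) {x : X} (hx : ∀ n, x ∈ (f n).U) :
    Tendsto (fun n => S.N (f n).x) atTop (𝓝 (S.N x)) := by
  have hpow : Tendsto (fun n : ℕ => ((1 : ℝ) / 2) ^ n) atTop (𝓝 0) :=
    tendsto_pow_atTop_nhds_zero_of_lt_one (by norm_num) (by norm_num)
  rw [tendsto_order]
  constructor
  · intro c hc
    obtain ⟨n, hn⟩ := hf.exists_U_subset hx (S.isOpen_lt_N c) hc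
    filter_upwards [eventually_ge_atTop n] with m hm
    exact hn (hf.antitone_U hm (hf.good m).1.mem)
  · intro c hc
    filter_upwards [hpow.eventually (gt_mem_nhds (sub_pos.2 hc))] with n hn
    linarith [(hf.good n).1.N_lt x (hx n)]

theorem abs_offset_sub_le (hf : S.IsChain T f) {n m : ℕ} (h : n ≤ m) :
    |S.offset T (f m) - S.offset T (f n)| ≤ 3 * (1 / 2) ^ n := by
  have : |S.offset T (f m) - S.offset T (f n)| ≤ 3 * (1 / 2) ^ n - 3 * (1 / 2) ^ m := by
    induction m, h using Nat.le_induction with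
    | base => simp
    | succ m hm ih =>
      have h1 := (hf.refines m).abs_offset_sub_lt
      have h2 := abs_sub_le (S.offset T (f (m + 1))) (S.offset T (f m)) (S.offset T (f n))
      have h3 : ((1 : ℝ) / 2) ^ (m + 1) = (1 / 2) ^ m / 2 := by rw [pow_succ]; ring
      rw [h3] at h1 ⊢
      linarith
  have h4 : (0 : ℝ) < (1 / 2) ^ m := by positivity
  linarith

theorem abs_sub_offset_le (hf : S.IsChain T f) {x : X} {y : Y} (hx : ∀ n, x ∈ (f n).U)
    (hy : ∀ n, y ∈ (f n).V) (n : ℕ) : |(T.N y - S.N x) - S.offset T (f n)| ≤ 3 * (1 / 2) ^ n := by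
  have h : Tendsto (fun m => |S.offset T (f m) - S.offset T (f n)|) atTop
      (𝓝 |(T.N y - S.N x) - S.offset T (f n)|) :=
    (((hf.swap.tendsto_N hy).sub (hf.tendsto_N hx)).sub_const _).abs
  exact le_of_tendsto h ((eventually_ge_atTop n).mono fun m hm => hf.abs_offset_sub_le hm)

theorem exists_mem_V (hf : S.IsChain T f) {x : X} (hx : ∀ n, x ∈ (f n).U) :
    ∃ y, ∀ n, y ∈ (f n).V := by
  have hmono : Monotone fun n => S.lev (f n).x := monotone_nat_of_le_succ fun n =>
    (hf.good n).1.lev_le _ ((hf.refines n).U_subset (hf.good (n + 1)).1.mem)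
  have hle : ∀ n, S.lev (f n).x ≤ S.lev x := fun n => (hf.good n).1.lev_le _ (hx n)
  obtain ⟨n₀, hn₀⟩ : ∃ n₀, ∀ n, n₀ ≤ n → S.lev (f n).x = S.lev (f n₀).x := by
    have hbdd : (Set.range fun n => S.lev (f n).x).Finite :=
      (Set.finite_le_nat (S.lev x)).subset (by rintro _ ⟨n, rfl⟩; exact hle n)
    obtain ⟨_, ⟨n₀, rfl⟩, hmax⟩ := hbdd.exists_maximal (Set.range_nonempty _)
    exact ⟨n₀, fun n hn => le_antisymm (hmax ⟨n, rfl⟩ (hmono hn)) (hmono hn)⟩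
  have hlev : ∀ n, n₀ ≤ n → T.lev (f n).y = T.lev (f n₀).y := by
    intro n hn
    induction n, hn using Nat.le_induction with
    | base => rfl
    | succ n hn ih =>
      rw [← ih]
      exact (hf.refines n).lev_eq_iff.1 (by rw [hn₀ n hn, hn₀ (n + 1) (by omega)])
  have hN : ∀ n, T.N (f n).y ≤ S.N x + 4 + S.offset T (f 0) := by
    intro n
    have h1 := (hf.good n).1.N_lt x (hx n)
    have h2 := abs_le.1 (hf.abs_offset_sub_le (Nat.zero_le n))
    have h3 : ((1 : ℝ) / 2) ^ n ≤ 1 := pow_le_one₀ (by norm_num) (by norm_num)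
    have h4 : T.N (f n).y = S.offset T (f n) + S.N (f n).x := by simp [offset]
    rw [pow_zero] at h2
    linarith
  have hK := T.isCompact (T.lev (f n₀).y) (S.N x + 4 + S.offset T (f 0))
  obtain ⟨y, hy⟩ := IsCompact.nonempty_iInter_of_sequence_nonempty_isCompact_isClosed
    (fun n => {y | T.lev y ≤ T.lev (f n₀).y ∧ T.N y ≤ S.N x + 4 + S.offset T (f 0)} ∩ (f n).V)
    (fun n => Set.inter_subset_inter_right _ (hf.refines n).V_subset)
    (fun n => ⟨(f (max n n₀)).y, ⟨(hlev _ (le_max_right _ _)).le, hN _⟩,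
      hf.antitone_V (le_max_left n n₀) (hf.good _).2.mem⟩)
    (hK.inter_right (hf.good 0).2.isClopen.1)
    (fun n => ((T.isClosed_lev _).inter (T.isClosed_N _)).inter (hf.good n).2.isClopen.1)
  exact ⟨y, fun n => (Set.mem_iInter.1 hy n).2⟩

end IsChain

/-- If `h` matches the members of chains, its extension to the graphs of `N` is continuous. -/
theorem tendsto_graph {h : X → Y} {x : X} {f : ℕ → MarkedPair X Y} (hf : S.IsChain T f)
    (hx : ∀ n, x ∈ (f n).U) (hU : ∀ n, ∀ x' ∈ (f n).U, h x' ∈ (f n).V ∧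
      |(T.N (h x') - S.N x') - S.offset T (f n)| ≤ 3 * (1 / 2) ^ n) :
    Tendsto (fun x' => (h x', T.N (h x'))) (comap (fun x' => (x', S.N x')) (𝓝 (x, S.N x)))
      (𝓝 (h x, T.N (h x))) := by
  have hcomap : Tendsto (fun x' => (x', S.N x')) (comap (fun x' => (x', S.N x')) (𝓝 (x, S.N x)))
    (𝓝 (x, S.N x)) := tendsto_comap
  have hfst := (continuous_fst.tendsto (x, S.N x)).comp hcomap
  have hsnd := (continuous_snd.tendsto (x, S.N x)).comp hcomap
  rw [nhds_prod_eq (x := h x), tendsto_prod_iff']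
  have hnhds : ∀ n, ∀ᶠ x' in comap (fun x' => (x', S.N x')) (𝓝 (x, S.N x)), x' ∈ (f n).U :=
    fun n => hfst ((hf.good n).1.isClopen.2.mem_nhds (hx n))
  constructor
  · intro O hO
    obtain ⟨O', hO', hOo, hxO⟩ := mem_nhds_iff.1 hO
    obtain ⟨n, hn⟩ := hf.swap.exists_U_subset (x := h x) (fun n => (hU n x (hx n)).1) hOo hxO
    exact (hnhds n).mono fun x' hx' => hO' (hn (hU n x' hx').1)
  · rw [Metric.tendsto_nhds]
    intro δ hδ
    obtain ⟨n, hn⟩ := exists_pow_lt_of_lt_one (show (0 : ℝ) < δ / 12 by positivity)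
      (show (1 : ℝ) / 2 < 1 by norm_num)
    filter_upwards [hnhds n, Metric.tendsto_nhds.1 hsnd (δ / 2) (by positivity)] with x' h1 h2
    simp only [Function.comp_apply, Real.dist_eq] at h2 ⊢
    have h3 := abs_le.1 (hU n x' h1).2
    have h4 := abs_le.1 (hU n x (hx n)).2
    rw [abs_lt] at h2 ⊢
    constructor <;> linarith

/-- Any two stratified spaces are related by a bijection which is a homeomorphism between the
graphs of the functions `N`. -/
theorem exists_equiv [T1Space X] [T1Space Y] : ∃ h : X ≃ Y,
    (∀ x, Tendsto (fun x' => (h x', T.N (h x'))) (comap (fun x' => (x', S.N x')) (𝓝 (x, S.N x)))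
      (𝓝 (h x, T.N (h x)))) ∧
    ∀ y, Tendsto (fun y' => (h.symm y', S.N (h.symm y')))
      (comap (fun y' => (y', T.N y')) (𝓝 (y, T.N y))) (𝓝 (h.symm y, S.N (h.symm y))) := by
  have hpow : ∀ n : ℕ, (0 : ℝ) < (1 / 2) ^ n := fun n => by positivity
  have href := fun (n : ℕ) (p : MarkedPair X Y) (hp : S.GoodPair T ((1 / 2) ^ n) p) =>
    S.exists_refinement T (hpow n) (hpow (n + 1)) hp (S.isClopen_b n) (T.isClopen_b n)
  choose! 𝓡 h𝓡 hexU hexV using href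
  obtain ⟨x₀, hx₀, hx₀'⟩ := S.base
  obtain ⟨y₀, hy₀, hy₀'⟩ := T.base
  let p₀ : MarkedPair X Y := ⟨Set.univ, x₀, Set.univ, y₀⟩
  have h0 : S.GoodPair T ((1 / 2) ^ 0) p₀ :=
    ⟨⟨isClopen_univ, trivial, fun z _ => by linarith [S.N_nonneg z, pow_zero ((1 : ℝ) / 2)],
      fun z _ => by simp [p₀, hx₀]⟩,
    ⟨isClopen_univ, trivial, fun z _ => by linarith [T.N_nonneg z, pow_zero ((1 : ℝ) / 2)],
      fun z _ => by simp [p₀, hy₀]⟩⟩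
  have hP := fun n p hp q hq => (h𝓡 n p hp q hq).1
  have hchain : ∀ f, IsBranch 𝓡 p₀ f → S.IsChain T f := fun f hf =>
    ⟨hf.induction h0 hP, fun n => (h𝓡 n _ (hf.induction h0 hP n) _ (hf.2 n)).2⟩
  have heqU : ∀ f g, IsBranch 𝓡 p₀ f → IsBranch 𝓡 p₀ g → ∀ n z, z ∈ (f n).U → z ∈ (g n).U →
      f n = g n := fun f g hf hg n z => IsBranch.eq_of_mem h0 hP hexU
    (fun n p hp q hq => (h𝓡 n p hp q hq).2.U_subset) hf hg
  have heqV : ∀ f g, IsBranch 𝓡 p₀ f → IsBranch 𝓡 p₀ g → ∀ n z, z ∈ (f n).V → z ∈ (g n).V →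
      f n = g n := fun f g hf hg n z => IsBranch.eq_of_mem h0 hP hexV
    (fun n p hp q hq => (h𝓡 n p hp q hq).2.V_subset) hf hg
  have hX : ∀ x, ∃ f y, IsBranch 𝓡 p₀ f ∧ (∀ n, x ∈ (f n).U) ∧ ∀ n, y ∈ (f n).V := fun x => by
    obtain ⟨f, hf, hx⟩ := exists_isBranch h0 hP hexU (Set.mem_univ x : x ∈ p₀.U)
    obtain ⟨y, hy⟩ := (hchain f hf).exists_mem_V hx
    exact ⟨f, y, hf, hx, hy⟩
  have hY : ∀ y, ∃ f x, IsBranch 𝓡 p₀ f ∧ (∀ n, x ∈ (f n).U) ∧ ∀ n, y ∈ (f n).V := fun y => by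
    obtain ⟨f, hf, hy⟩ := exists_isBranch h0 hP hexV (Set.mem_univ y : y ∈ p₀.V)
    obtain ⟨x, hx⟩ := (hchain f hf).swap.exists_mem_V hy
    exact ⟨f, x, hf, hx, hy⟩
  choose F h hF hFU hFV using hX
  choose F' g hF' hFU' hFV' using hY
  have hgh : ∀ x, g (h x) = x := fun x => by
    refine (hchain _ (hF x)).eq_of_mem_U (fun n => ?_) (hFU x)
    rw [heqV _ _ (hF x) (hF' (h x)) n (h x) (hFV x n) (hFV' _ n)]
    exact hFU' _ n
  have hhg : ∀ y, h (g y) = y := fun y => by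
    refine (hchain _ (hF' y)).swap.eq_of_mem_U (fun n => ?_) (hFV' y)
    rw [heqU _ _ (hF' y) (hF (g y)) n (g y) (hFU' y n) (hFU _ n)]
    exact hFV _ n
  refine ⟨⟨h, g, hgh, hhg⟩, fun x => ?_, fun y => ?_⟩
  · refine S.tendsto_graph T (hchain _ (hF x)) (hFU x) fun n x' hx' => ?_
    have := heqU _ _ (hF x) (hF x') n x' hx' (hFU x' n)
    rw [this]
    exact ⟨hFV x' n, (hchain _ (hF x')).abs_sub_offset_le (hFU x') (hFV x') n⟩
  · refine T.tendsto_graph S (hchain _ (hF' y)).swap (hFV' y) fun n y' hy' => ?_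
    have := heqV _ _ (hF' y) (hF' y') n y' hy' (hFV' y' n)
    rw [this]
    exact ⟨hFU' y' n, (hchain _ (hF' y')).swap.abs_sub_offset_le (hFV' y') (hFU' y') n⟩

end Stratification

theorem Stratification.nonempty_homeomorph {A B X Y : Type*} [TopologicalSpace A]
    [TopologicalSpace B] [TopologicalSpace X] [TopologicalSpace Y] [T1Space X] [T1Space Y]
    (S : Stratification X) (T : Stratification Y) (i : A ≃ X) (j : B ≃ Y)
    (hi : IsInducing fun a => (i a, S.N (i a))) (hj : IsInducing fun b => (j b, T.N (j b))) :
    Nonempty (A ≃ₜ B) := by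
  obtain ⟨h, h1, h2⟩ := S.exists_equiv T
  refine ⟨⟨(i.trans h).trans j.symm, ?_, ?_⟩⟩
  · refine hj.continuous_iff.2 (continuous_iff_continuousAt.2 fun a => ?_)
    have : Tendsto i (𝓝 a) (comap (fun x' => (x', S.N x')) (𝓝 (i a, S.N (i a)))) := by
      rw [tendsto_comap_iff]
      exact hi.continuous.tendsto a
    simpa [ContinuousAt, Function.comp_def] using (h1 (i a)).comp this
  · refine hi.continuous_iff.2 (continuous_iff_continuousAt.2 fun b => ?_)
    have : Tendsto j (𝓝 b) (comap (fun y' => (y', T.N y')) (𝓝 (j b, T.N (j b)))) := by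
      rw [tendsto_comap_iff]
      exact hj.continuous.tendsto b
    simpa [ContinuousAt, Function.comp_def] using (h2 (j b)).comp this

theorem isInducing_of_tendsto {A X : Type*} [TopologicalSpace A] [TopologicalSpace X] {f : A → X}
    (hf : Continuous f) (h : ∀ a, Tendsto id (comap f (𝓝 (f a))) (𝓝 a)) : IsInducing f :=
  isInducing_iff_nhds.2 fun a =>
    le_antisymm (tendsto_iff_comap.1 (hf.tendsto a)) (tendsto_id'.1 (h a))

section InducedByCoordinates

variable {X ι : Type*} [TopologicalSpace X] {F : X → ι → ℝ}

theorem Topology.IsInducing.exists_finset_agree (hF : IsInducing F) {O : Set X} (hO : IsOpen O)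
    {x : X} (hx : x ∈ O) : ∃ I : Finset ι, ∀ x', (∀ i ∈ I, F x' i = F x i) → x' ∈ O := by
  obtain ⟨O', hO', rfl⟩ := hF.isOpen_iff.1 hO
  obtain ⟨I, u, hu, hsub⟩ := isOpen_pi_iff.1 hO' _ hx
  refine ⟨I, fun x' h => hsub fun i hi => ?_⟩
  rw [h i hi]
  exact (hu i hi).2

theorem Topology.IsInducing.exists_clopen_basis [Countable ι] (hF : IsInducing F)
    (hc : ∀ i, (Set.range fun x => F x i).Countable) : ∃ b : ℕ → Set X, (∀ n, IsClopen (b n)) ∧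
      ∀ x O, IsOpen O → x ∈ O → ∃ n, x ∈ b n ∧ b n ⊆ O := by
  have hD : Dense (⋃ i, Set.range fun x => F x i)ᶜ := (Set.countable_iUnion hc).dense_compl ℝ
  obtain ⟨D, hDsub, hDc, hDd⟩ := hD.exists_countable_dense_subset
  have : Countable D := hDc
  let C : ι × D × D → Set X := fun j => {x | F x j.1 ∈ Set.Ioo (j.2.1 : ℝ) j.2.2}
  have hC : ∀ j, IsClopen (C j) := by
    rintro ⟨i, q, r⟩
    have hcont : Continuous fun x => F x i := (continuous_apply i).comp hF.continuous
    refine ⟨?_, isOpen_Ioo.preimage hcont⟩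
    have : C (i, q, r) = (fun x => F x i) ⁻¹' Set.Icc (q : ℝ) r := by
      ext x
      have hne : ∀ d : D, F x i ≠ d := fun d h =>
        hDsub d.2 (Set.mem_iUnion.2 ⟨i, x, h⟩)
      exact ⟨fun h => ⟨h.1.le, h.2.le⟩,
        fun h => ⟨lt_of_le_of_ne h.1 (hne q).symm, lt_of_le_of_ne h.2 (hne r)⟩⟩
    rw [this]
    exact isClosed_Icc.preimage hcont
  obtain ⟨e, he⟩ := exists_surjective_nat (Finset (ι × D × D))
  refine ⟨fun n => ⋂ j ∈ e n, C j, fun n => isClopen_biInter_finset fun j _ => hC j, ?_⟩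
  intro x O hO hx
  obtain ⟨O', hO', rfl⟩ := hF.isOpen_iff.1 hO
  obtain ⟨I, u, hu, hsub⟩ := isOpen_pi_iff.1 hO' _ hx
  have hex : ∀ i ∈ I, ∃ q r : D, F x i ∈ Set.Ioo (q : ℝ) r ∧ Set.Ioo (q : ℝ) r ⊆ u i := by
    intro i hi
    obtain ⟨l, r, ⟨hl, hr⟩, hlr⟩ := mem_nhds_iff_exists_Ioo_subset.1 ((hu i hi).1.mem_nhds (hu i hi).2)
    obtain ⟨q', hq', hq1, hq2⟩ := hDd.exists_between hl
    obtain ⟨r', hr', hr1, hr2⟩ := hDd.exists_between hr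
    exact ⟨⟨q', hq'⟩, ⟨r', hr'⟩, ⟨hq2, hr1⟩, (Set.Ioo_subset_Ioo hq1.le hr2.le).trans hlr⟩
  classical
  have : Nonempty D := hDd.nonempty.to_subtype
  choose! q r hqr hsub' using hex
  obtain ⟨n, hn⟩ := he (I.image fun i => (i, q i, r i))
  refine ⟨n, ?_, fun z hz => hsub fun i hi => hsub' i hi ?_⟩
  · simp only [hn, Set.mem_iInter, Finset.mem_image]
    rintro _ ⟨i, hi, rfl⟩
    exact hqr i hi
  · simp only [hn, Set.mem_iInter, Finset.mem_image] at hz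
    exact hz _ ⟨i, hi, rfl⟩

end InducedByCoordinates

/-- The possible coordinates of a point of complete Erdős space. -/
def erdosCoords : Set ℝ := insert 0 (Set.range fun m : ℕ => 1 / ((m : ℝ) + 1))

theorem isCompact_erdosCoords : IsCompact erdosCoords :=
  tendsto_one_div_add_atTop_nhds_zero_nat.isCompact_insert_range

theorem countable_erdosCoords : erdosCoords.Countable := (Set.countable_range _).insert _

namespace Ec

/-- The coordinates of a point of complete Erdős space. -/
def coord (x : Ec) (n : ℕ) : ℝ := (x : lp (fun _ : ℕ => ℝ) 2) n

/-- The square of the norm of a point of complete Erdős space. -/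
def sqNorm (x : Ec) : ℝ := ‖(x : lp (fun _ : ℕ => ℝ) 2)‖ ^ 2

theorem coord_mem (x : Ec) (n : ℕ) : x.coord n ∈ erdosCoords := by
  rcases x.2 n with h | ⟨m, h⟩
  · exact Or.inl h
  · exact Or.inr ⟨m, h.symm⟩

theorem coord_nonneg (x : Ec) (n : ℕ) : 0 ≤ x.coord n := by
  rcases x.coord_mem n with h | ⟨m, h⟩
  · exact h.ge
  · rw [← h]
    positivity

theorem ext_coord {x y : Ec} (h : ∀ n, x.coord n = y.coord n) : x = y :=
  Subtype.ext (lp.ext (funext h))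

theorem continuous_coord (n : ℕ) : Continuous fun x : Ec => x.coord n := by
  have h : Continuous fun x : lp (fun _ : ℕ => ℝ) 2 => x n := by
    refine LipschitzWith.continuous (K := 1) (LipschitzWith.of_dist_le_mul fun x y => ?_)
    rw [NNReal.coe_one, one_mul, dist_eq_norm, dist_eq_norm]
    exact lp.norm_apply_le_norm two_ne_zero (x - y) n
  exact h.comp continuous_subtype_val

theorem continuous_sqNorm : Continuous sqNorm := (continuous_norm.comp continuous_subtype_val).pow 2

theorem sqNorm_nonneg (x : Ec) : 0 ≤ x.sqNorm := sq_nonneg _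

theorem hasSum_sqNorm (x : Ec) : HasSum (fun n => x.coord n ^ 2) x.sqNorm := by
  have := lp.hasSum_inner (𝕜 := ℝ) x.1 x.1
  rw [real_inner_self_eq_norm_sq] at this
  simpa [coord, sqNorm, pow_two] using this

theorem sum_le_sqNorm (x : Ec) (n : ℕ) : ∑ k ∈ Finset.range n, x.coord k ^ 2 ≤ x.sqNorm :=
  sum_le_hasSum _ (fun _ _ => sq_nonneg _) x.hasSum_sqNorm

theorem sqNorm_le_iff {x : Ec} {t : ℝ} :
    x.sqNorm ≤ t ↔ ∀ n, ∑ k ∈ Finset.range n, x.coord k ^ 2 ≤ t :=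
  ⟨fun h n => (x.sum_le_sqNorm n).trans h,
    fun h => le_of_tendsto' x.hasSum_sqNorm.tendsto_sum_nat h⟩

theorem exists_coord_eq {a : ℕ → ℝ} (ha : ∀ n, a n ∈ erdosCoords)
    (hs : Summable fun n => a n ^ 2) : ∃ x : Ec, ∀ n, x.coord n = a n := by
  have h : Memℓp (E := fun _ : ℕ => ℝ) a 2 := by
    refine memℓp_gen ?_
    simpa using hs
  refine ⟨⟨⟨a, h⟩, fun n => ?_⟩, fun n => rfl⟩
  rcases ha n with h | ⟨m, h⟩
  · exact Or.inl h
  · exact Or.inr ⟨m, h.symm⟩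

instance : Zero Ec := ⟨⟨0, fun _ => Or.inl rfl⟩⟩

@[simp]
theorem coord_zero (n : ℕ) : (0 : Ec).coord n = 0 := rfl

@[simp]
theorem sqNorm_zero : (0 : Ec).sqNorm = 0 := by
  change ‖(0 : lp (fun _ : ℕ => ℝ) 2)‖ ^ 2 = 0
  simp

/-- Coordinatewise convergence together with convergence of norms implies convergence. -/
theorem tendsto_of_coord {α : Type*} {l : Filter α} {u : α → Ec} {x : Ec}
    (h : ∀ n, Tendsto (fun a => (u a).coord n) l (𝓝 (x.coord n)))
    (hN : Tendsto (fun a => (u a).sqNorm) l (𝓝 x.sqNorm)) : Tendsto u l (𝓝 x) := by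
  rw [tendsto_subtype_rng, tendsto_iff_norm_sub_tendsto_zero]
  suffices hsq : Tendsto (fun a => ‖(u a : lp (fun _ : ℕ => ℝ) 2) - x‖ ^ 2) l (𝓝 0) by
    have := hsq.sqrt
    simpa using this
  have hbound : ∀ a K, ‖(u a : lp (fun _ : ℕ => ℝ) 2) - x‖ ^ 2 ≤
      (u a).sqNorm + x.sqNorm - 2 * ∑ k ∈ Finset.range K, (u a).coord k * x.coord k := by
    intro a K
    have h1 : ∑ k ∈ Finset.range K, (u a).coord k * x.coord k ≤
        inner ℝ (u a : lp (fun _ : ℕ => ℝ) 2) x := by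
      have := lp.hasSum_inner (𝕜 := ℝ) (u a).1 x.1
      refine sum_le_hasSum _ (fun k _ => mul_nonneg ((u a).coord_nonneg k) (x.coord_nonneg k))
        (f := fun k => (u a).coord k * x.coord k) (L := SummationFilter.unconditional ℕ) ?_
      simpa [coord, mul_comm] using this
    rw [norm_sub_sq_real]
    simp only [sqNorm]
    linarith
  rw [tendsto_order]
  refine ⟨fun c hc => Eventually.of_forall fun a => hc.trans_le (sq_nonneg _), fun c hc => ?_⟩
  obtain ⟨K, hK⟩ := (x.hasSum_sqNorm.tendsto_sum_nat.eventually
    (lt_mem_nhds (show x.sqNorm - c / 2 < x.sqNorm by linarith))).exists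
  have hlim : Tendsto (fun a => (u a).sqNorm + x.sqNorm -
      2 * ∑ k ∈ Finset.range K, (u a).coord k * x.coord k) l
      (𝓝 (x.sqNorm + x.sqNorm - 2 * ∑ k ∈ Finset.range K, x.coord k * x.coord k)) :=
    (hN.add_const _).sub ((tendsto_finsetSum _ fun k _ => (h k).mul_const _).const_mul 2)
  simp only [← pow_two] at hlim
  filter_upwards [hlim.eventually (gt_mem_nhds (show _ < c by linarith))] with a ha
  exact (hbound a K).trans_lt ha

/-- The norm can be increased to nearly any value without changing the first coordinates. -/
theorem exists_agree_sqNorm (x : Ec) {t δ : ℝ} (ht : x.sqNorm < t) (hδ : 0 < δ) (K : ℕ) :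
    ∃ x' : Ec, (∀ n < K, x'.coord n = x.coord n) ∧ |x'.sqNorm - t| < δ := by
  set s := ∑ k ∈ Finset.range K, x.coord k ^ 2 with hs
  have hst : s < t := (x.sum_le_sqNorm K).trans_lt ht
  obtain ⟨m, hm⟩ := exists_nat_one_div_lt hδ
  set r : ℝ := 1 / ((m : ℝ) + 1) with hr
  have hr0 : 0 < r := by positivity
  have hr1 : r ≤ 1 := by
    rw [hr, div_le_one (by positivity)]
    linarith [m.cast_nonneg (α := ℝ)]
  have hr2 : r ^ 2 < δ := by nlinarith
  set k := ⌊(t - s) / r ^ 2⌋₊ with hk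
  have hk1 : k * r ^ 2 ≤ t - s := by
    rw [← le_div_iff₀ (by positivity)]
    exact Nat.floor_le (div_nonneg (by linarith) (by positivity))
  have hk2 : t - s < (k + 1) * r ^ 2 := by
    rw [← div_lt_iff₀ (by positivity)]
    exact Nat.lt_floor_add_one _
  let a : ℕ → ℝ := fun n => if n < K then x.coord n else if n < K + k then r else 0
  have hsum : HasSum (fun n => a n ^ 2) (s + k * r ^ 2) := by
    have h0 : ∀ n ∉ Finset.range (K + k), a n ^ 2 = 0 := by
      intro n hn
      rw [Finset.mem_range] at hn
      have h1 : ¬ n < K := by omega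
      simp [a, h1, hn]
    have h1 := hasSum_sum_of_ne_finset_zero (L := SummationFilter.unconditional ℕ) h0
    rw [Finset.sum_range_add] at h1
    convert h1 using 2
    · exact Finset.sum_congr rfl fun n hn => by simp [a, Finset.mem_range.1 hn]
    · rw [Finset.sum_congr rfl (g := fun _ => r ^ 2) fun n hn => by
        simp [a, Finset.mem_range.1 hn]]
      simp
  obtain ⟨x', hx'⟩ := exists_coord_eq (a := a) (fun n => by
    simp only [a]
    split_ifs
    · exact x.coord_mem n
    · exact Or.inr ⟨m, rfl⟩
    · exact Or.inl rfl) hsum.summable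
  have hx'N : x'.sqNorm = s + k * r ^ 2 := by
    have := x'.hasSum_sqNorm
    simp only [hx'] at this
    exact this.unique hsum
  refine ⟨x', fun n hn => by simp [hx', a, hn], ?_⟩
  rw [hx'N, abs_lt]
  constructor <;> linarith

end Ec

/-- `ℚ × Ec` with the topology of coordinatewise convergence. -/
def RatEc : Type := ℚ × Ec

namespace RatEc

/-- The coordinates of a point of `ℚ × Ec`. -/
def coord (p : RatEc) : Option ℕ → ℝ := fun i => i.elim (p.1 : ℝ) p.2.coord

instance : TopologicalSpace RatEc := induced coord inferInstance

theorem isInducing_coord : IsInducing coord := ⟨rfl⟩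

theorem injective_coord : Function.Injective coord := by
  rintro ⟨q, x⟩ ⟨q', x'⟩ h
  have h1 : (q : ℝ) = q' := congrFun h none
  have h2 : x = x' := Ec.ext_coord fun n => congrFun h (some n)
  rw [Rat.cast_injective h1, h2]

instance : T1Space RatEc :=
  (IsEmbedding.mk isInducing_coord injective_coord).t1Space

theorem continuous_coord (i : Option ℕ) : Continuous fun p => coord p i :=
  (continuous_apply i).comp isInducing_coord.continuous

theorem countable_range_coord (i : Option ℕ) : (Set.range fun p => coord p i).Countable := by
  rcases i with _ | n
  · refine (Set.countable_range fun q : ℚ => (q : ℝ)).mono ?_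
    rintro _ ⟨p, rfl⟩
    exact ⟨p.1, rfl⟩
  · refine countable_erdosCoords.mono ?_
    rintro _ ⟨p, rfl⟩
    exact p.2.coord_mem n

theorem isClosed_sqNorm_le (t : ℝ) : IsClosed {p : RatEc | p.2.sqNorm ≤ t} := by
  simp only [Ec.sqNorm_le_iff, Set.ofPred_forall]
  exact isClosed_iInter fun n => isClosed_le
    (continuous_finsetSum _ fun k _ => (continuous_coord (some k)).pow 2) continuous_const

theorem finite_index_le (m : ℕ) : {q : ℚ | Denumerable.eqv ℚ q ≤ m}.Finite :=
  (Set.finite_le_nat m).preimage (Denumerable.eqv ℚ).injective.injOn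

theorem index_le_iff {p : RatEc} {m : ℕ} : Denumerable.eqv ℚ p.1 ≤ m ↔
    coord p none ∈ (fun q : ℚ => (q : ℝ)) '' {q : ℚ | Denumerable.eqv ℚ q ≤ m} :=
  (Rat.cast_injective.mem_set_image (s := {q : ℚ | Denumerable.eqv ℚ q ≤ m})).symm

theorem isClosed_index_le (m : ℕ) : IsClosed {p : RatEc | Denumerable.eqv ℚ p.1 ≤ m} := by
  simp only [index_le_iff]
  exact ((finite_index_le m).image _).isClosed.preimage (continuous_coord none)

theorem isCompact_index_le_sqNorm_le (m : ℕ) (t : ℝ) :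
    IsCompact {p : RatEc | Denumerable.eqv ℚ p.1 ≤ m ∧ p.2.sqNorm ≤ t} := by
  rw [isInducing_coord.isCompact_iff]
  let Q : Set ℝ := (fun q : ℚ => (q : ℝ)) '' {q : ℚ | Denumerable.eqv ℚ q ≤ m}
  have hK : IsCompact (Set.univ.pi fun i : Option ℕ => i.elim Q fun _ => erdosCoords) := by
    refine isCompact_univ_pi ?_
    rintro (_ | n)
    · exact ((finite_index_le m).image _).isCompact
    · exact isCompact_erdosCoords
  have hC : IsClosed {a : Option ℕ → ℝ | ∀ n, ∑ k ∈ Finset.range n, a (some k) ^ 2 ≤ t} := by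
    simp only [Set.ofPred_forall]
    exact isClosed_iInter fun n => isClosed_le
      (continuous_finsetSum _ fun k _ => (continuous_apply (some k)).pow 2) continuous_const
  convert hK.inter_right hC using 1
  ext a
  constructor
  · rintro ⟨p, ⟨h1, h2⟩, rfl⟩
    refine ⟨?_, Ec.sqNorm_le_iff.1 h2⟩
    rintro (_ | n) -
    · exact index_le_iff.1 h1
    · exact p.2.coord_mem n
  · rintro ⟨h1, h2⟩
    obtain ⟨q, hq, hqa⟩ := h1 none trivial
    obtain ⟨x, hx⟩ := Ec.exists_coord_eq (a := fun n => a (some n)) (fun n => h1 (some n) trivial)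
      (summable_of_sum_range_le (fun _ => sq_nonneg _) h2)
    refine ⟨(q, x), ⟨hq, Ec.sqNorm_le_iff.2 fun n => ?_⟩, ?_⟩
    · simpa [hx] using h2 n
    · ext (_ | n)
      · exact hqa
      · exact hx n

theorem exists_same_index {p : RatEc} {t δ : ℝ} {O : Set RatEc} (ht : p.2.sqNorm < t) (hδ : 0 < δ)
    (hO : IsOpen O) (hp : p ∈ O) : ∃ p' ∈ O, p'.1 = p.1 ∧ |p'.2.sqNorm - t| < δ := by
  obtain ⟨I, hI⟩ := isInducing_coord.exists_finset_agree hO hp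
  obtain ⟨x', hx', hx'N⟩ := p.2.exists_agree_sqNorm ht hδ (I.sup (fun i => i.elim 0 Nat.succ))
  refine ⟨(p.1, x'), hI _ ?_, rfl, hx'N⟩
  rintro (_ | n) hi
  · rfl
  · exact hx' n (Finset.le_sup (f := fun i : Option ℕ => i.elim 0 Nat.succ) hi)

theorem exists_larger_index {p : RatEc} {O : Set RatEc} (hO : IsOpen O) (hp : p ∈ O) :
    ∃ p' ∈ O, Denumerable.eqv ℚ p.1 < Denumerable.eqv ℚ p'.1 ∧ p'.2 = p.2 := by
  let u : ℕ → ℚ := fun n => p.1 + 1 / ((n : ℚ) + 1)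
  have hinj : Function.Injective u := by
    intro n m h
    have h1 : (1 : ℚ) / (n + 1) = 1 / (m + 1) := add_left_cancel h
    have h2 : (n : ℚ) + 1 = m + 1 := by simpa using h1
    exact_mod_cast add_right_cancel h2
  have hlev := ((Denumerable.eqv ℚ).injective.comp hinj).nat_tendsto_atTop
  let v : ℕ → RatEc := fun n => (u n, p.2)
  have hconv : Tendsto v atTop (𝓝 p) := by
    rw [isInducing_coord.tendsto_nhds_iff, tendsto_pi_nhds]
    rintro (_ | n)
    · have := (tendsto_one_div_add_atTop_nhds_zero_nat (𝕜 := ℝ)).const_add (p.1 : ℝ)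
      have h : Tendsto (fun n => (u n : ℝ)) atTop (𝓝 (p.1 : ℝ)) := by simpa [u] using this
      exact h
    · exact tendsto_const_nhds
  obtain ⟨n, h1, h2⟩ := ((hconv.eventually (hO.mem_nhds hp)).and
    (hlev.eventually_gt_atTop (Denumerable.eqv ℚ p.1))).exists
  exact ⟨_, h1, h2, rfl⟩

theorem exists_stratification : ∃ S : Stratification RatEc, ∀ p, S.N p = p.2.sqNorm := by
  obtain ⟨b, hb, hb'⟩ := isInducing_coord.exists_clopen_basis countable_range_coord
  refine ⟨{ N := fun p => p.2.sqNorm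
            lev := fun p => Denumerable.eqv ℚ p.1
            b := b
            isClopen_b := hb
            basis := hb'
            N_nonneg := fun p => p.2.sqNorm_nonneg
            isClosed_N := isClosed_sqNorm_le
            isClosed_lev := isClosed_index_le
            isCompact := isCompact_index_le_sqNorm_le
            dense_same := fun p t δ O ht hδ hO hp => ?_
            dense_up := fun p δ O hδ hO hp => ?_
            base := ⟨((Denumerable.eqv ℚ).symm 0, 0), by simp, Ec.sqNorm_zero⟩ }, fun p => rfl⟩
  · obtain ⟨p', h1, h2, h3⟩ := exists_same_index ht hδ hO hp
    exact ⟨p', h1, by rw [h2], h3⟩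
  · obtain ⟨p', h1, h2, h3⟩ := exists_larger_index hO hp
    exact ⟨p', h1, h2, by rw [h3]; linarith⟩

/-- The identity from `ℚ × Ec` to `RatEc`. -/
def equiv : (ℚ × Ec) ≃ RatEc := Equiv.refl _

theorem isInducing_graph :
    IsInducing fun p : ℚ × Ec => (equiv p, p.2.sqNorm) := by
  have hcoord : Continuous fun p : ℚ × Ec => equiv p := by
    refine isInducing_coord.continuous_iff.2 (continuous_pi ?_)
    rintro (_ | n)
    · exact Rat.continuous_coe_real.comp continuous_fst
    · exact (Ec.continuous_coord n).comp continuous_snd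
  refine isInducing_of_tendsto (hcoord.prodMk (Ec.continuous_sqNorm.comp continuous_snd))
    fun p => ?_
  have hcomap := tendsto_comap (f := fun p : ℚ × Ec => (equiv p, p.2.sqNorm))
    (x := 𝓝 (equiv p, p.2.sqNorm))
  have h1 := fun i => ((continuous_coord i).tendsto _).comp ((continuous_fst.tendsto _).comp hcomap)
  have h2 := (continuous_snd.tendsto _).comp hcomap
  rw [nhds_prod_eq (x := p.1), tendsto_prod_iff']
  exact ⟨Rat.isEmbedding_coe_real.isInducing.tendsto_nhds_iff.2 (h1 none),
    Ec.tendsto_of_coord (fun n => h1 (some n)) h2⟩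

end RatEc

/-- If the total of nonnegative lower semicontinuous terms is continuous, then so is every term. -/
theorem tendsto_of_tendsto_hasSum {α ι : Type*} {l : Filter α} {f : α → ι → ℝ} {g : ι → ℝ}
    {s : α → ℝ} {S : ℝ} (hf : ∀ a i, 0 ≤ f a i) (hfs : ∀ a, HasSum (f a) (s a)) (hg : HasSum g S)
    (hs : Tendsto s l (𝓝 S)) (h : ∀ i, ∀ c < g i, ∀ᶠ a in l, c < f a i) (i : ι) :
    Tendsto (fun a => f a i) l (𝓝 (g i)) := by
  classical
  refine tendsto_order.2 ⟨h i, fun c hc => ?_⟩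
  obtain ⟨ε, hε, rfl⟩ : ∃ ε, 0 < ε ∧ c = g i + 3 * ε := ⟨(c - g i) / 3, by linarith, by ring⟩
  obtain ⟨I, hI⟩ := (((tendsto_order.1 hg).1 (S - ε) (by linarith)).and
    (eventually_ge_atTop {i})).exists
  obtain ⟨hI1, hI2⟩ := hI
  have hi : i ∈ I := hI2 (Finset.mem_singleton_self i)
  have hη : 0 < ε / ((I.erase i).card + 1) := by positivity
  have h1 : ∀ᶠ a in l, ∀ j ∈ I.erase i, g j - ε / ((I.erase i).card + 1) < f a j :=
    (Finset.eventually_all _).2 fun j _ => h j _ (by linarith)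
  filter_upwards [h1, hs.eventually (gt_mem_nhds (show S < S + ε by linarith))] with a ha hsa
  have h2 : ∑ j ∈ I.erase i, g j - ε ≤ ∑ j ∈ I.erase i, f a j := by
    have h3 := Finset.sum_le_sum fun j hj => (ha j hj).le
    rw [Finset.sum_sub_distrib, Finset.sum_const, nsmul_eq_mul] at h3
    have h4 : ((I.erase i).card : ℝ) * (ε / ((I.erase i).card + 1)) ≤ ε := by
      rw [mul_div_assoc', div_le_iff₀ (by positivity)]
      nlinarith
    linarith
  have h5 : ∑ j ∈ I, f a j ≤ s a := sum_le_hasSum I (fun j _ => hf a j) (hfs a)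
  rw [← Finset.add_sum_erase _ _ hi] at h5 hI1
  linarith

theorem tendsto_of_tendsto_strictMonoOn {α : Type*} {l : Filter α} {φ : ℝ → ℝ} {u : α → ℝ} {x : ℝ}
    (hφ : StrictMonoOn φ (Set.Ici 0)) (hu : ∀ a, 0 ≤ u a) (hx : 0 ≤ x)
    (h : Tendsto (fun a => φ (u a)) l (𝓝 (φ x))) : Tendsto u l (𝓝 x) := by
  refine tendsto_order.2 ⟨fun c hc => ?_, fun c hc => ?_⟩
  · rcases lt_or_ge c 0 with hc0 | hc0
    · exact Eventually.of_forall fun a => hc0.trans_le (hu a)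
    · filter_upwards [(tendsto_order.1 h).1 _ (hφ hc0 hx hc)] with a ha
      exact (hφ.lt_iff_lt hc0 (hu a)).1 ha
  · have hc0 : 0 ≤ c := hx.trans hc.le
    filter_upwards [(tendsto_order.1 h).2 _ (hφ hx hc0 hc)] with a ha
    exact (hφ.lt_iff_lt (hu a) hc0).1 ha

/-- The σ-product of complete Erdős space with the topology of coordinatewise convergence. -/
def SigmaEc : Type := ↥sigmaErdos

namespace SigmaEc

/-- The identity from the σ-product to `SigmaEc`. -/
def equiv : ↥sigmaErdos ≃ SigmaEc := Equiv.refl _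

/-- The rows of a point of the σ-product. -/
def row (y : SigmaEc) : ℕ → Ec := y.1

/-- The coordinates of a point of the σ-product. -/
def coord (y : SigmaEc) (i : ℕ × ℕ) : ℝ := (y.row i.1).coord i.2

instance : TopologicalSpace SigmaEc := induced coord inferInstance

theorem isInducing_coord : IsInducing coord := ⟨rfl⟩

theorem ext_row {y z : SigmaEc} (h : ∀ i, y.row i = z.row i) : y = z := Subtype.ext (funext h)

theorem injective_coord : Function.Injective coord := fun _ _ h =>
  ext_row fun i => Ec.ext_coord fun n => congrFun h (i, n)

instance : T1Space SigmaEc :=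
  (IsEmbedding.mk isInducing_coord injective_coord).t1Space

theorem countable_range_coord (i : ℕ × ℕ) : (Set.range fun y => coord y i).Countable := by
  refine countable_erdosCoords.mono ?_
  rintro _ ⟨y, rfl⟩
  exact (y.row i.1).coord_mem i.2

theorem finite_row_ne_zero (y : SigmaEc) : {i | y.row i ≠ 0}.Finite :=
  y.2.subset fun _ hi h => hi (Subtype.ext h)

theorem exists_row_eq {r : ℕ → Ec} (hr : {i | r i ≠ 0}.Finite) : ∃ y : SigmaEc, y.row = r :=
  ⟨⟨r, hr.subset fun _ hi h => hi (congrArg Subtype.val h)⟩, rfl⟩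

theorem exists_row_eq_update (y : SigmaEc) (i : ℕ) (x : Ec) :
    ∃ z : SigmaEc, z.row = Function.update y.row i x := by
  refine exists_row_eq ((y.finite_row_ne_zero.insert i).subset fun j hj => ?_)
  by_cases h : j = i
  · exact Or.inl h
  · exact Or.inr (by simpa [h] using hj)

/-- Reparametrisations of `[0, ∞)` which are summable from the index `1` on. -/
def weight : ℕ → ℝ → ℝ
  | 0, s => s
  | i + 1, s => (1 / 2) ^ (i + 1) * (s / (1 + s))

@[simp]
theorem weight_apply_zero (i : ℕ) : weight i 0 = 0 := by
  cases i <;> simp [weight]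

theorem strictMonoOn_weight (i : ℕ) : StrictMonoOn (weight i) (Set.Ici 0) := by
  intro s hs t ht hst
  rw [Set.mem_Ici] at hs ht
  cases i with
  | zero => exact hst
  | succ i =>
    refine mul_lt_mul_of_pos_left ?_ (by positivity)
    rw [div_lt_div_iff₀ (by linarith) (by linarith)]
    nlinarith

theorem weight_mono (i : ℕ) {s t : ℝ} (hs : 0 ≤ s) (hst : s ≤ t) : weight i s ≤ weight i t :=
  (strictMonoOn_weight i).monotoneOn hs (hs.trans hst) hst

theorem weight_nonneg (i : ℕ) {s : ℝ} (hs : 0 ≤ s) : 0 ≤ weight i s := by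
  simpa using weight_mono i le_rfl hs

theorem weight_succ_le (i : ℕ) {s : ℝ} (hs : 0 ≤ s) : weight (i + 1) s ≤ (1 / 2) ^ (i + 1) := by
  refine mul_le_of_le_one_right (by positivity) ?_
  rw [div_le_one (by linarith)]
  linarith

theorem continuousOn_weight (i : ℕ) : ContinuousOn (weight i) (Set.Ici 0) := by
  cases i with
  | zero => exact continuousOn_id
  | succ i =>
    refine continuousOn_const.mul (continuousOn_id.div (continuousOn_const.add continuousOn_id) ?_)
    intro s hs
    have : (0 : ℝ) ≤ s := hs
    exact (by positivity : (0 : ℝ) < 1 + s).ne'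

theorem continuous_weight_comp {Z : Type*} [TopologicalSpace Z] (i : ℕ) {f : Z → ℝ}
    (hf : Continuous f) (h : ∀ z, 0 ≤ f z) : Continuous fun z => weight i (f z) :=
  (continuousOn_weight i).comp_continuous hf h

/-- The total weight of a point of the σ-product. -/
def height (y : SigmaEc) : ℝ := ∑' i, weight i (y.row i).sqNorm

theorem hasSum_height (y : SigmaEc) : HasSum (fun i => weight i (y.row i).sqNorm) y.height := by
  refine (summable_of_hasFiniteSupport (y.finite_row_ne_zero.subset fun i hi h => hi ?_)).hasSum
  simp [h]

theorem height_nonneg (y : SigmaEc) : 0 ≤ y.height :=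
  tsum_nonneg fun i => weight_nonneg i (y.row i).sqNorm_nonneg

theorem height_of_row_eq_update {y z : SigmaEc} {i : ℕ} {x : Ec}
    (h : z.row = Function.update y.row i x) :
    z.height = weight i x.sqNorm - weight i (y.row i).sqNorm + y.height := by
  have hupdate : (fun j => weight j (z.row j).sqNorm) =
      Function.update (fun j => weight j (y.row j).sqNorm) i (weight i x.sqNorm) := by
    funext j
    rw [h]
    by_cases hj : j = i
    · subst hj
      simp
    · simp [hj]
  refine z.hasSum_height.unique ?_
  rw [hupdate]
  exact y.hasSum_height.update i (weight i x.sqNorm)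

/-- A partial sum of the total weight in terms of the coordinates. -/
def partialHeight (n : ℕ) (a : ℕ × ℕ → ℝ) : ℝ :=
  ∑ i ∈ Finset.range n, weight i (∑ k ∈ Finset.range n, a (i, k) ^ 2)

theorem continuous_partialHeight (n : ℕ) : Continuous (partialHeight n) :=
  continuous_finsetSum _ fun i _ => continuous_weight_comp i
    (continuous_finsetSum _ fun k _ => (continuous_apply (i, k)).pow 2)
    fun _ => Finset.sum_nonneg fun _ _ => sq_nonneg _

theorem tendsto_weight_sum (y : SigmaEc) (i : ℕ) :
    Tendsto (fun n => weight i (∑ k ∈ Finset.range n, y.coord (i, k) ^ 2)) atTop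
      (𝓝 (weight i (y.row i).sqNorm)) :=
  ((continuousOn_weight i) _ (y.row i).sqNorm_nonneg).tendsto.comp
    (tendsto_nhdsWithin_iff.2 ⟨(y.row i).hasSum_sqNorm.tendsto_sum_nat,
      Eventually.of_forall fun _ => Set.mem_Ici.2 (Finset.sum_nonneg fun _ _ => sq_nonneg _)⟩)

theorem height_le_iff {y : SigmaEc} {t : ℝ} :
    y.height ≤ t ↔ ∀ n, partialHeight n y.coord ≤ t := by
  refine ⟨fun h n => le_trans ?_ h, fun h => ?_⟩
  · refine (Finset.sum_le_sum fun i _ => ?_).trans (sum_le_hasSum (Finset.range n)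
      (fun i _ => weight_nonneg i (y.row i).sqNorm_nonneg) y.hasSum_height)
    exact weight_mono i (Finset.sum_nonneg fun _ _ => sq_nonneg _) ((y.row i).sum_le_sqNorm n)
  · refine le_of_tendsto' y.hasSum_height.tendsto_sum_nat fun M => ?_
    refine le_of_tendsto (tendsto_finsetSum _ fun i _ => y.tendsto_weight_sum i) ?_
    filter_upwards [eventually_ge_atTop M] with n hn
    refine le_trans (Finset.sum_le_sum_of_subset_of_nonneg (Finset.range_mono hn) ?_) (h n)
    exact fun i _ _ => weight_nonneg i (Finset.sum_nonneg fun _ _ => sq_nonneg _)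

/-- The coordinates of points which vanish in the rows above `m` and whose rows other than the
first one have squared norm at most `m`. -/
def levelSet (m : ℕ) : Set (ℕ × ℕ → ℝ) :=
  {a | (∀ i, m < i → ∀ n, a (i, n) = 0) ∧
    ∀ i, 0 < i → ∀ n, ∑ k ∈ Finset.range n, a (i, k) ^ 2 ≤ m}

theorem isClosed_levelSet (m : ℕ) : IsClosed (levelSet m) := by
  simp only [levelSet, Set.ofPred_and, Set.ofPred_forall]
  refine IsClosed.inter ?_ ?_
  · exact isClosed_iInter fun i => isClosed_iInter fun _ => isClosed_iInter fun n =>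
      isClosed_eq (continuous_apply (i, n)) continuous_const
  · exact isClosed_iInter fun i => isClosed_iInter fun _ => isClosed_iInter fun n =>
      isClosed_le (continuous_finsetSum _ fun k _ => (continuous_apply (i, k)).pow 2)
        continuous_const

theorem monotone_levelSet : Monotone levelSet := fun _ _ h _ ha =>
  ⟨fun i hi => ha.1 i (lt_of_le_of_lt h hi),
    fun i hi n => (ha.2 i hi n).trans (Nat.cast_le.2 h)⟩

theorem exists_coord_mem_levelSet (y : SigmaEc) : ∃ m, y.coord ∈ levelSet m := by
  obtain ⟨M, hM⟩ := y.finite_row_ne_zero.bddAbove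
  have hz : ∀ i, M < i → y.row i = 0 := fun i hi => by
    by_contra h
    exact absurd (hM h) (not_le.2 hi)
  obtain ⟨B, hB⟩ := exists_nat_ge (∑ i ∈ Finset.range (M + 1), (y.row i).sqNorm)
  refine ⟨max M B, fun i hi n => ?_, fun i _ => ?_⟩
  · rw [coord, hz i ((le_max_left _ _).trans_lt hi), Ec.coord_zero]
  · refine (Ec.sqNorm_le_iff (x := y.row i)).1 ?_
    rcases lt_or_ge M i with h | h
    · rw [hz i h, Ec.sqNorm_zero]
      positivity
    · refine le_trans ?_ (hB.trans (Nat.cast_le.2 (le_max_right _ _)))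
      exact Finset.single_le_sum (f := fun i => (y.row i).sqNorm)
        (fun j _ => (y.row j).sqNorm_nonneg) (Finset.mem_range.2 (by omega))

open Classical in
/-- The first level to which a point belongs. -/
def level (y : SigmaEc) : ℕ := Nat.find y.exists_coord_mem_levelSet

theorem level_le_iff {y : SigmaEc} {m : ℕ} : y.level ≤ m ↔ y.coord ∈ levelSet m := by
  classical
  refine ⟨fun h => monotone_levelSet h ?_, fun h => Nat.find_min' _ h⟩
  exact Nat.find_spec y.exists_coord_mem_levelSet

theorem isClosed_height_le (t : ℝ) : IsClosed {y : SigmaEc | y.height ≤ t} := by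
  simp only [height_le_iff, Set.ofPred_forall]
  exact isClosed_iInter fun n => isClosed_le
    ((continuous_partialHeight n).comp isInducing_coord.continuous) continuous_const

theorem isClosed_level_le (m : ℕ) : IsClosed {y : SigmaEc | y.level ≤ m} := by
  simp only [level_le_iff]
  exact (isClosed_levelSet m).preimage isInducing_coord.continuous

theorem isCompact_level_le_height_le (m : ℕ) (t : ℝ) :
    IsCompact {y : SigmaEc | y.level ≤ m ∧ y.height ≤ t} := by
  rw [isInducing_coord.isCompact_iff]
  have hK : IsCompact (Set.univ.pi fun _ : ℕ × ℕ => erdosCoords) :=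
    isCompact_univ_pi fun _ => isCompact_erdosCoords
  have hC : IsClosed {a : ℕ × ℕ → ℝ | ∀ n, partialHeight n a ≤ t} := by
    simp only [Set.ofPred_forall]
    exact isClosed_iInter fun n => isClosed_le (continuous_partialHeight n) continuous_const
  convert hK.inter_right ((isClosed_levelSet m).inter hC) using 1
  ext a
  constructor
  · rintro ⟨y, ⟨h1, h2⟩, rfl⟩
    exact ⟨fun i _ => (y.row i.1).coord_mem i.2, level_le_iff.1 h1, height_le_iff.1 h2⟩
  · rintro ⟨h1, h2, h3⟩
    have hbound : ∀ i, ∃ B : ℝ, ∀ n, ∑ k ∈ Finset.range n, a (i, k) ^ 2 ≤ B := by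
      rintro (_ | i)
      · refine ⟨t, fun n => le_trans ?_ (h3 (n + 1))⟩
        refine (Finset.sum_le_sum_of_subset_of_nonneg (Finset.range_mono n.le_succ)
          fun _ _ _ => sq_nonneg _).trans ?_
        exact Finset.single_le_sum
          (f := fun i => weight i (∑ k ∈ Finset.range (n + 1), a (i, k) ^ 2))
          (fun i _ => weight_nonneg i (Finset.sum_nonneg fun _ _ => sq_nonneg _))
          (Finset.mem_range.2 n.succ_pos)
      · exact ⟨m, h2.2 (i + 1) i.succ_pos⟩
    choose B hB using hbound
    choose r hr using fun i => Ec.exists_coord_eq (a := fun n => a (i, n))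
      (fun n => h1 (i, n) trivial) (summable_of_sum_range_le (fun _ => sq_nonneg _) (hB i))
    obtain ⟨y, hy⟩ := exists_row_eq (r := r) ((Set.finite_le_nat m).subset fun i hi => by
      by_contra hmi
      exact hi (Ec.ext_coord fun n => (hr i n).trans (h2.1 i (not_le.1 hmi) n)))
    have hya : y.coord = a := by
      ext ⟨i, n⟩
      rw [coord, hy, hr]
    exact ⟨y, ⟨level_le_iff.2 (hya ▸ h2), height_le_iff.2 (hya ▸ h3)⟩, hya⟩

theorem exists_same_level {y : SigmaEc} {t δ : ℝ} {O : Set SigmaEc} (ht : y.height < t)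
    (hδ : 0 < δ) (hO : IsOpen O) (hy : y ∈ O) :
    ∃ y' ∈ O, y'.level = y.level ∧ |y'.height - t| < δ := by
  obtain ⟨I, hI⟩ := isInducing_coord.exists_finset_agree hO hy
  obtain ⟨x, hx, hxN⟩ := (y.row 0).exists_agree_sqNorm
    (t := t - y.height + (y.row 0).sqNorm) (by linarith) hδ (I.sup fun i => i.2 + 1)
  obtain ⟨z, hz⟩ := y.exists_row_eq_update 0 x
  have hrow : ∀ i, 0 < i → z.row i = y.row i := fun i hi => by
    rw [hz, Function.update_of_ne hi.ne']
  refine ⟨z, hI z ?_, ?_, ?_⟩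
  · rintro ⟨i, n⟩ hi
    rcases Nat.eq_zero_or_pos i with rfl | h
    · rw [coord, hz]
      simpa [coord] using hx n (Finset.le_sup (f := fun i : ℕ × ℕ => i.2 + 1) hi)
    · rw [coord, hrow i h, coord]
  · refine eq_of_forall_ge_iff fun m => ?_
    simp only [level_le_iff, levelSet, coord, Set.mem_ofPred_eq]
    refine and_congr (forall₂_congr fun i hi => ?_) (forall₂_congr fun i hi => ?_)
    · rw [hrow i (Nat.zero_lt_of_lt hi)]
    · rw [hrow i hi]
  · rw [height_of_row_eq_update hz]
    convert hxN using 2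
    simp only [weight]
    ring

theorem exists_larger_level {y : SigmaEc} {δ : ℝ} {O : Set SigmaEc} (hδ : 0 < δ) (hO : IsOpen O)
    (hy : y ∈ O) : ∃ y' ∈ O, y.level < y'.level ∧ y'.height < y.height + δ := by
  obtain ⟨e, -, he⟩ := (0 : Ec).exists_agree_sqNorm (t := 1) (δ := 1) (by simp) one_pos 0
  have he0 : e ≠ 0 := by
    rintro rfl
    simp at he
  choose z hz using fun n : ℕ => y.exists_row_eq_update (n + 1) e
  have hconv : Tendsto z atTop (𝓝 y) := by
    rw [isInducing_coord.tendsto_nhds_iff, tendsto_pi_nhds]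
    rintro ⟨i, k⟩
    refine tendsto_const_nhds.congr' ?_
    filter_upwards [eventually_ge_atTop i] with n hn
    rw [Function.comp_apply, coord, coord, hz, Function.update_of_ne (by omega)]
  have hpow : Tendsto (fun n : ℕ => (1 / 2 : ℝ) ^ (n + 1)) atTop (𝓝 0) :=
    (tendsto_pow_atTop_nhds_zero_of_lt_one (by norm_num) (by norm_num)).comp
      (tendsto_add_atTop_nat 1)
  obtain ⟨n, h1, h2, h3⟩ := ((hconv.eventually (hO.mem_nhds hy)).and
    ((hpow.eventually (gt_mem_nhds hδ)).and (eventually_ge_atTop y.level))).exists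
  refine ⟨z n, h1, h3.trans_lt ?_, ?_⟩
  · by_contra! h
    refine he0 (Ec.ext_coord fun k => ?_)
    have := (level_le_iff.1 h).1 (n + 1) n.lt_succ_self k
    simpa [coord, hz] using this
  · rw [height_of_row_eq_update (hz n)]
    have h4 := weight_succ_le n e.sqNorm_nonneg
    have h5 := weight_nonneg (n + 1) (y.row (n + 1)).sqNorm_nonneg
    linarith

theorem exists_level_eq_zero : ∃ y : SigmaEc, y.level = 0 ∧ y.height = 0 := by
  obtain ⟨y, hy⟩ := exists_row_eq (r := fun _ => 0) (by simp)
  refine ⟨y, Nat.le_zero.1 (level_le_iff.2 ?_), ?_⟩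
  · simp [levelSet, coord, hy]
  · simp [height, hy]

theorem exists_stratification : ∃ S : Stratification SigmaEc, ∀ y, S.N y = y.height := by
  obtain ⟨b, hb, hb'⟩ := isInducing_coord.exists_clopen_basis countable_range_coord
  exact ⟨{ N := height
           lev := level
           b := b
           isClopen_b := hb
           basis := hb'
           N_nonneg := height_nonneg
           isClosed_N := isClosed_height_le
           isClosed_lev := isClosed_level_le
           isCompact := isCompact_level_le_height_le
           dense_same := fun _ _ _ _ => exists_same_level
           dense_up := fun _ _ _ => exists_larger_level
           base := exists_level_eq_zero }, fun _ => rfl⟩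

theorem continuous_row_equiv (i : ℕ) : Continuous fun y : ↥sigmaErdos => (equiv y).row i :=
  (continuous_apply i).comp continuous_subtype_val

theorem continuous_height_equiv : Continuous fun y : ↥sigmaErdos => (equiv y).height := by
  have h : ∀ i, Continuous fun y : ↥sigmaErdos => weight i ((equiv y).row i).sqNorm := fun i =>
    continuous_weight_comp i (Ec.continuous_sqNorm.comp (continuous_row_equiv i))
      fun y => ((equiv y).row i).sqNorm_nonneg
  have hsum : Summable fun i : ℕ => (1 / 2 : ℝ) ^ (i + 1) :=
    (summable_nat_add_iff 1).2 (summable_geometric_of_lt_one (by norm_num) (by norm_num))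
  have heq : (fun y : ↥sigmaErdos => (equiv y).height) = fun y : ↥sigmaErdos =>
      weight 0 ((equiv y).row 0).sqNorm + ∑' i, weight (i + 1) ((equiv y).row (i + 1)).sqNorm :=
    funext fun y => (equiv y).hasSum_height.summable.tsum_eq_zero_add
  rw [heq]
  refine (h 0).add (continuous_tsum (fun i => h (i + 1)) hsum fun i y => ?_)
  have h0 := ((equiv y).row (i + 1)).sqNorm_nonneg
  rw [Real.norm_of_nonneg (weight_nonneg _ h0)]
  exact weight_succ_le i h0

theorem tendsto_row {α : Type*} {l : Filter α} {u : α → SigmaEc} {y : SigmaEc}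
    (hu : Tendsto u l (𝓝 y)) (hN : Tendsto (fun a => (u a).height) l (𝓝 y.height)) (i : ℕ) :
    Tendsto (fun a => (u a).row i) l (𝓝 (y.row i)) := by
  have hcoord := tendsto_pi_nhds.1 (isInducing_coord.tendsto_nhds_iff.1 hu)
  refine Ec.tendsto_of_coord (fun n => hcoord (i, n)) ?_
  refine tendsto_of_tendsto_strictMonoOn (strictMonoOn_weight i)
    (fun a => ((u a).row i).sqNorm_nonneg) (y.row i).sqNorm_nonneg ?_
  refine tendsto_of_tendsto_hasSum (f := fun a i => weight i ((u a).row i).sqNorm)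
    (fun a i => weight_nonneg i ((u a).row i).sqNorm_nonneg) (fun a => (u a).hasSum_height)
    y.hasSum_height hN (fun i c hc => ?_) i
  obtain ⟨n, hn⟩ := ((y.tendsto_weight_sum i).eventually (lt_mem_nhds hc)).exists
  have hcont : Continuous fun z : SigmaEc =>
      weight i (∑ k ∈ Finset.range n, z.coord (i, k) ^ 2) :=
    continuous_weight_comp i (continuous_finsetSum _ fun k _ =>
      ((continuous_apply (i, k)).comp isInducing_coord.continuous).pow 2)
      fun _ => Finset.sum_nonneg fun _ _ => sq_nonneg _
  filter_upwards [((hcont.tendsto y).comp hu).eventually (lt_mem_nhds hn)] with a ha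
  exact ha.trans_le (weight_mono i (Finset.sum_nonneg fun _ _ => sq_nonneg _)
    (((u a).row i).sum_le_sqNorm n))

theorem isInducing_graph :
    IsInducing fun y : ↥sigmaErdos => (equiv y, (equiv y).height) := by
  have hequiv : Continuous equiv := isInducing_coord.continuous_iff.2 <| continuous_pi fun i =>
    (Ec.continuous_coord i.2).comp (continuous_row_equiv i.1)
  refine isInducing_of_tendsto (hequiv.prodMk continuous_height_equiv) fun y => ?_
  have hcomap := tendsto_comap (f := fun y : ↥sigmaErdos => (equiv y, (equiv y).height))
    (x := 𝓝 (equiv y, (equiv y).height))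
  rw [tendsto_subtype_rng, tendsto_pi_nhds]
  exact fun i => tendsto_row ((continuous_fst.tendsto _).comp hcomap)
    ((continuous_snd.tendsto _).comp hcomap) i

end SigmaEc

/-- The σ-product of complete Erdős space is homeomorphic to ℚ × 𝔈_c. -/
theorem sigma_product_homeomorphic_rat_prod_Ec :
    Nonempty (↥sigmaErdos ≃ₜ (ℚ × Ec)) := by
  obtain ⟨S, hS⟩ := SigmaEc.exists_stratification
  obtain ⟨T, hT⟩ := RatEc.exists_stratification
  refine S.nonempty_homeomorph T SigmaEc.equiv RatEc.equiv ?_ ?_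
  · simpa only [hS] using SigmaEc.isInducing_graph
  · simp only [hT]
    exact RatEc.isInducing_graph
end
end

section
/- The endpoint set E(𝓕) of the dynamical model, with its subspace topology from ℝ × ℤ^ω, is homeomorphic to complete Erdős space 𝔈_c. -/
/- Complete Erdős space 𝔈_c, realized inside the real Hilbert space ℓ². -/

noncomputable section
open Topology Filter TopologicalSpace

/- The dynamical model: F(t) = 3^t − 1 acting on ℝ × ℤ^ω (ℤ discrete, product topology). -/

/-- `F t = 3 ^ t - 1` (real exponent). -/
def F : ℝ → ℝ := fun t => (3 : ℝ) ^ t - 1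

/-- The inverse of `F` on `[0, ∞)`: `F⁻¹ t = log₃ (t + 1)`. -/
def Finv : ℝ → ℝ := fun t => Real.logb 3 (t + 1)

/-- The shift map on integer sequences. -/
def shift : (ℕ → ℤ) → (ℕ → ℤ) := fun s n => s (n + 1)

/-- The map 𝓕(t, s) = (F(t) − |s₀|, σ(s)). -/
def calF : ℝ × (ℕ → ℤ) → ℝ × (ℕ → ℤ) :=
  fun x => (F x.1 - (|x.2 0| : ℝ), shift x.2)

/-- J(𝓕) = {x : T(𝓕ⁿ(x)) ≥ 0 for all n ≥ 0} (the case n = 0 forces T(x) ≥ 0). -/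
def J : Set (ℝ × (ℕ → ℤ)) := {x | ∀ n : ℕ, 0 ≤ (calF^[n] x).1}

/-- 𝕊 = {s ∈ ℤ^ω : (t, s) ∈ J(𝓕) for some t ≥ 0}. -/
def Sset : Set (ℕ → ℤ) := {s | ∃ t : ℝ, 0 ≤ t ∧ (t, s) ∈ J}

/-- t_s = min {t ≥ 0 : (t, s) ∈ J(𝓕)} (as an infimum; for s ∈ 𝕊 it is attained). -/
def tmin (s : ℕ → ℤ) : ℝ := sInf {t : ℝ | (t, s) ∈ J}

/-- The endpoint set E(𝓕) = {(t_s, s) : s ∈ 𝕊}, a subspace of ℝ × ℤ^ω. -/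
def Efan : Set (ℝ × (ℕ → ℤ)) := {x | x.2 ∈ Sset ∧ x.1 = tmin x.2}

/-- t*_s = sup_{k ≥ 1} F^{−k}(|s_k|). -/
def tstar (s : ℕ → ℤ) : ℝ := ⨆ k : ℕ, Finv^[k + 1] (|s (k + 1)| : ℝ)

/-- X_n = {x ∈ E(𝓕) : t*_{σ^{2k²}(s(x))} > F^{k−n}(1) for all k > n}. -/
def Xfan (n : ℕ) : Set ↥Efan :=
  {x | ∀ k : ℕ, n < k → F^[k - n] 1 < tstar (shift^[2 * k ^ 2] (x : ℝ × (ℕ → ℤ)).2)}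

/-! ### Proper functions with upward closed local values on zero-dimensional spaces -/

/-- A Lelek-type function: `φ` is proper, the family of clopen sets coded by `u` induces the
topology, and the values of `φ` on an open set form an upward closed set. -/
structure IsLelek {X ι : Type*} [TopologicalSpace X] (φ : X → ℝ) (u : X → ι → Bool) : Prop where
  isInducing : IsInducing u
  isCompact_le : ∀ r, IsCompact {x | φ x ≤ r}
  exists_eq : ∀ U, IsOpen U → ∀ x ∈ U, ∀ t, φ x ≤ t → ∃ y ∈ U, φ y = t

/-- The infimum of `φ` on `A`. -/
def infOn {X : Type*} (φ : X → ℝ) (A : Set X) : ℝ := sInf (φ '' A)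

lemma infOn_eq {X : Type*} {φ : X → ℝ} {A : Set X} {a : X} (ha : a ∈ A)
    (h : ∀ x ∈ A, φ a ≤ φ x) : infOn φ A = φ a :=
  IsLeast.csInf_eq ⟨⟨a, ha, rfl⟩, by rintro _ ⟨x, hx, rfl⟩; exact h x hx⟩

namespace IsLelek

variable {X ι : Type*} [TopologicalSpace X] {φ : X → ℝ} {u : X → ι → Bool}

lemma exists_isClopen (h : IsLelek φ u) {U : Set X} (hU : IsOpen U) {x : X} (hx : x ∈ U) :
    ∃ W, IsClopen W ∧ x ∈ W ∧ W ⊆ U := by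
  obtain ⟨O, hO, rfl⟩ := h.isInducing.isOpen_iff.1 hU
  obtain ⟨V, hV, hxV, hVO⟩ := compact_exists_isClopen_in_isOpen hO hx
  exact ⟨u ⁻¹' V, hV.preimage h.isInducing.continuous, hxV, Set.preimage_mono hVO⟩

variable [T2Space X]

lemma isOpen_gt (h : IsLelek φ u) (r : ℝ) : IsOpen {x | r < φ x} := by
  have := (h.isCompact_le r).isClosed.isOpen_compl
  convert this using 1
  ext x
  simp

lemma exists_min (h : IsLelek φ u) {A : Set X} (hA : IsClosed A) (hne : A.Nonempty) :
    ∃ a ∈ A, φ a = infOn φ A ∧ ∀ x ∈ A, φ a ≤ φ x := by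
  obtain ⟨c, hc⟩ := hne
  have hls : LowerSemicontinuous φ :=
    lowerSemicontinuous_iff_isClosed_preimage.2 fun r => (h.isCompact_le r).isClosed
  obtain ⟨a, ha, hmin⟩ := LowerSemicontinuousOn.exists_isMinOn (f := φ)
    (s := {x | φ x ≤ φ c} ∩ A) ⟨c, le_refl (φ c), hc⟩ ((h.isCompact_le _).inter_right hA)
    (hls.lowerSemicontinuousOn _)
  have hle : ∀ x ∈ A, φ a ≤ φ x := fun x hx => by
    by_cases hxc : φ x ≤ φ c
    · exact hmin ⟨hxc, hx⟩
    · exact ha.1.trans (not_le.1 hxc).le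
  exact ⟨a, ha.2, (infOn_eq ha.2 hle).symm, hle⟩

lemma infOn_le (h : IsLelek φ u) {A : Set X} (hA : IsClosed A) {x : X} (hx : x ∈ A) :
    infOn φ A ≤ φ x := by
  obtain ⟨a, -, e, hle⟩ := h.exists_min hA ⟨x, hx⟩
  exact e ▸ hle x hx

/-- In a clopen set one can cut off a clopen piece on which the infimum is almost any prescribed
value above the infimum of the whole set, without changing the latter. -/
lemma exists_cut (h : IsLelek φ u) {B : Set X} (hB : IsClopen B) (hne : B.Nonempty) {t ε : ℝ}
    (ht : infOn φ B ≤ t) (hε : 0 < ε) :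
    ∃ W ⊆ B, IsClopen W ∧ W.Nonempty ∧ (B \ W).Nonempty ∧ |infOn φ W - t| ≤ ε ∧
      infOn φ (B \ W) = infOn φ B := by
  obtain ⟨b, hb, hbe, hbmin⟩ := h.exists_min hB.1 hne
  obtain ⟨y, hy, hyt⟩ := h.exists_eq B hB.2 b hb (t + ε) (by linarith)
  obtain ⟨W, hW, hyW, hWs⟩ := h.exists_isClopen (U := B ∩ {x | t < φ x})
    (hB.2.inter (h.isOpen_gt t)) ⟨hy, by simp only [Set.mem_ofPred_eq]; linarith⟩
  obtain ⟨w, hw, hwe, -⟩ := h.exists_min hW.1 ⟨y, hyW⟩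
  have h1 : infOn φ W ≤ φ y := h.infOn_le hW.1 hyW
  have h2 : t < φ w := (hWs hw).2
  have hbW : b ∉ W := fun hbW => by
    have : t < φ b := (hWs hbW).2
    linarith
  refine ⟨W, fun x hx => (hWs hx).1, hW, ⟨y, hyW⟩, ⟨b, hb, hbW⟩, ?_, ?_⟩
  · rw [abs_le]; constructor <;> linarith
  · rw [← hbe]
    exact infOn_eq ⟨hb, hbW⟩ fun x hx => hbmin x hx.1

end IsLelek

section Matching

variable {X Y ι κ : Type*} [TopologicalSpace X] [TopologicalSpace Y]
  {φ : X → ℝ} {ψ : Y → ℝ} {u : X → ι → Bool} {v : Y → κ → Bool}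

lemma IsLelek.exists_split [T2Space X] [T2Space Y] (hφ : IsLelek φ u) (hψ : IsLelek ψ v)
    {A U : Set X} {B : Set Y} (hA : IsClopen A) (hU : IsClopen U) (hB : IsClopen B)
    (hAB : A.Nonempty ↔ B.Nonempty) {ε : ℝ} (hε : 0 < ε) :
    ∃ V, IsClopen V ∧ ((A ∩ U).Nonempty ↔ (B ∩ V).Nonempty) ∧
      ((A \ U).Nonempty ↔ (B \ V).Nonempty) ∧
      ((A ∩ U).Nonempty → |(infOn φ (A ∩ U) - infOn ψ (B ∩ V)) - (infOn φ A - infOn ψ B)| ≤ ε) ∧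
      ((A \ U).Nonempty → |(infOn φ (A \ U) - infOn ψ (B \ V)) - (infOn φ A - infOn ψ B)| ≤ ε) := by
  rcases (A ∩ U).eq_empty_or_nonempty with h1 | h1
  · have h2 : A \ U = A := (Set.disjoint_iff_inter_eq_empty.2 h1).sdiff_eq_left
    exact ⟨∅, isClopen_empty, by simp [h1], by simp [h2, hAB], by simp [h1], by simp [h2, hε.le]⟩
  rcases (A \ U).eq_empty_or_nonempty with h2 | h2
  · have h3 : A ∩ U = A := Set.inter_eq_left.2 (Set.sdiff_eq_empty.1 h2)
    exact ⟨Set.univ, isClopen_univ, by simp [h3, hAB], by simp [h2], by simp [h3, hε.le],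
      by simp [h2]⟩
  have hAne : A.Nonempty := h1.mono Set.inter_subset_left
  have hBne := hAB.1 hAne
  obtain ⟨a, ha, hae, hmin⟩ := hφ.exists_min hA.1 hAne
  by_cases haU : a ∈ U
  · have e : infOn φ (A ∩ U) = infOn φ A := by
      rw [← hae]; exact infOn_eq ⟨ha, haU⟩ fun x hx => hmin x hx.1
    obtain ⟨c, hc, hce, -⟩ := hφ.exists_min (hA.1.sdiff hU.2) h2
    obtain ⟨W, hWB, hW, hWne, hBW, hWt, hBWe⟩ := hψ.exists_cut hB hBne
      (t := infOn φ (A \ U) - infOn φ A + infOn ψ B) (by have := hmin c hc.1; linarith) hε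
    have i1 : B ∩ Wᶜ = B \ W := rfl
    have i2 : B \ Wᶜ = W := by rw [sdiff_compl]; exact Set.inter_eq_right.2 hWB
    refine ⟨Wᶜ, hW.compl, by simp [i1, h1, hBW], by simp [i2, h2, hWne], fun _ => ?_, fun _ => ?_⟩
    · rw [i1, e, hBWe]; simp [hε.le]
    · rw [i2, abs_sub_comm]; convert hWt using 2; ring
  · have e : infOn φ (A \ U) = infOn φ A := by
      rw [← hae]; exact infOn_eq ⟨ha, haU⟩ fun x hx => hmin x hx.1
    obtain ⟨c, hc, hce, -⟩ := hφ.exists_min (hA.1.inter hU.1) h1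
    obtain ⟨W, hWB, hW, hWne, hBW, hWt, hBWe⟩ := hψ.exists_cut hB hBne
      (t := infOn φ (A ∩ U) - infOn φ A + infOn ψ B) (by have := hmin c hc.1; linarith) hε
    have i2 : B ∩ W = W := Set.inter_eq_right.2 hWB
    refine ⟨W, hW, by simp [i2, h1, hWne], by simp [h2, hBW], fun _ => ?_, fun _ => ?_⟩
    · rw [i2, abs_sub_comm]; convert hWt using 2; ring
    · rw [e, hBWe]; simp [hε.le]

/-- A pair of matched finite clopen codings of two spaces, realizing the same codes. -/
structure Matching (X Y : Type*) [TopologicalSpace X] [TopologicalSpace Y] where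
  p : X → List Bool
  q : Y → List Bool
  hp : IsLocallyConstant p
  hq : IsLocallyConstant q
  nonempty_iff : ∀ a, (p ⁻¹' {a}).Nonempty ↔ (q ⁻¹' {a}).Nonempty

namespace Matching

/-- The difference of the infima of `φ` and `ψ` on the cells with code `a`. -/
def gap (φ : X → ℝ) (ψ : Y → ℝ) (c : Matching X Y) (a : List Bool) : ℝ :=
  infOn φ (c.p ⁻¹' {a}) - infOn ψ (c.q ⁻¹' {a})

/-- Exchange the two sides of a matching. -/
def swap (c : Matching X Y) : Matching Y X :=
  ⟨c.q, c.p, c.hq, c.hp, fun a => (c.nonempty_iff a).symm⟩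

/-- `c'` refines `c` by one bit, given by `b` and `d`, moving gaps by at most `ε`. -/
def Refines (φ : X → ℝ) (ψ : Y → ℝ) (c c' : Matching X Y) (b : X → Bool) (d : Y → Bool)
    (ε : ℝ) : Prop :=
  c'.p = (fun x => b x :: c.p x) ∧ c'.q = (fun y => d y :: c.q y) ∧
    ∀ x, |c'.gap φ ψ (c'.p x) - c.gap φ ψ (c.p x)| ≤ ε

lemma Refines.swap {c c' : Matching X Y} {b : X → Bool} {d : Y → Bool} {ε : ℝ}
    (h : c.Refines φ ψ c' b d ε) : c.swap.Refines ψ φ c'.swap d b ε := by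
  obtain ⟨h1, h2, h3⟩ := h
  refine ⟨h2, h1, fun y => ?_⟩
  obtain ⟨x, hx⟩ := (c'.nonempty_iff (c'.q y)).2 ⟨y, rfl⟩
  have hx' : c'.p x = c'.q y := hx
  have hxc : c.p x = c.q y := by
    have := hx'
    rw [h1, h2] at this
    exact (List.cons.inj this).2
  have := h3 x
  rw [hx'] at this
  simp only [gap, Matching.swap] at this ⊢
  rw [hxc] at this
  rw [← abs_neg]
  convert this using 2
  ring

lemma exists_refines_left [T2Space X] [T2Space Y] (hφ : IsLelek φ u) (hψ : IsLelek ψ v)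
    (c : Matching X Y) {ε : ℝ} (hε : 0 < ε) {b : X → Bool} (hb : IsLocallyConstant b) :
    ∃ (d : Y → Bool) (c' : Matching X Y), c.Refines φ ψ c' b d ε := by
  classical
  have hU : IsClopen (b ⁻¹' {true}) := hb.isClopen_fiber true
  choose V hV h1 h2 h3 h4 using fun a => hφ.exists_split hψ (c.hp.isClopen_fiber a) hU
    (c.hq.isClopen_fiber a) (c.nonempty_iff a) hε
  set d : Y → Bool := fun y => decide (y ∈ V (c.q y)) with hd
  have hdl : IsLocallyConstant d := by
    rw [IsLocallyConstant.iff_exists_open]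
    intro y
    by_cases hy : y ∈ V (c.q y)
    · refine ⟨_, (c.hq.isClopen_fiber (c.q y)).2.inter (hV (c.q y)).2, ⟨rfl, hy⟩, ?_⟩
      rintro z ⟨hz, hzV⟩
      simp only [Set.mem_ofPred_eq] at hz
      simp [hd, hz, hy, hzV]
    · refine ⟨_, (c.hq.isClopen_fiber (c.q y)).2.inter (hV (c.q y)).compl.2, ⟨rfl, hy⟩, ?_⟩
      rintro z ⟨hz, hzV⟩
      simp only [Set.mem_ofPred_eq] at hz
      simp only [Set.mem_compl_iff] at hzV
      simp [hd, hz, hy, hzV]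
  have e1 : ∀ a, (fun x => b x :: c.p x) ⁻¹' {true :: a} = {x | c.p x = a} ∩ b ⁻¹' {true} := by
    intro a; ext x; simp [and_comm]
  have e2 : ∀ a, (fun x => b x :: c.p x) ⁻¹' {false :: a} = {x | c.p x = a} \ b ⁻¹' {true} := by
    intro a; ext x; simp [and_comm]
  have e3 : ∀ a, (fun y => d y :: c.q y) ⁻¹' {true :: a} = {y | c.q y = a} ∩ V a := by
    intro a; ext y
    simp only [hd, Set.mem_preimage, Set.mem_singleton_iff, List.cons.injEq,
      decide_eq_true_eq, Set.mem_inter_iff, Set.mem_ofPred_eq]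
    grind
  have e4 : ∀ a, (fun y => d y :: c.q y) ⁻¹' {false :: a} = {y | c.q y = a} \ V a := by
    intro a; ext y
    simp only [hd, Set.mem_preimage, Set.mem_singleton_iff, List.cons.injEq,
      decide_eq_false_iff_not, Set.mem_sdiff, Set.mem_ofPred_eq]
    grind
  refine ⟨d, ⟨fun x => b x :: c.p x, fun y => d y :: c.q y,
    (hb.prodMk c.hp).comp fun z => z.1 :: z.2, (hdl.prodMk c.hq).comp fun z => z.1 :: z.2, ?_⟩,
    rfl, rfl, ?_⟩
  · rintro (_ | ⟨β, a⟩)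
    · constructor <;> rintro ⟨x, hx⟩ <;> simp at hx
    · cases β
      · rw [e2, e4]; exact h2 a
      · rw [e1, e3]; exact h1 a
  · intro x
    simp only [gap]
    cases hx : b x
    · rw [e2, e4]; exact h4 _ ⟨x, rfl, by simp [hx]⟩
    · rw [e1, e3]; exact h3 _ ⟨x, rfl, by simp [hx]⟩

lemma exists_refines_right [T2Space X] [T2Space Y] (hφ : IsLelek φ u) (hψ : IsLelek ψ v)
    (c : Matching X Y) {ε : ℝ} (hε : 0 < ε) {d : Y → Bool} (hd : IsLocallyConstant d) :
    ∃ (b : X → Bool) (c' : Matching X Y), c.Refines φ ψ c' b d ε := by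
  obtain ⟨b, c', h⟩ := exists_refines_left hψ hφ c.swap hε hd
  exact ⟨b, c'.swap, h.swap⟩

lemma exists_refines [T2Space X] [T2Space Y] (hφ : IsLelek φ u) (hψ : IsLelek ψ v)
    (c : Matching X Y) {ε : ℝ} (hε : 0 < ε) (i : ι ⊕ κ) :
    ∃ (c' : Matching X Y) (b : X → Bool) (d : Y → Bool), c.Refines φ ψ c' b d ε ∧
      Sum.elim (fun i => ∀ x, b x = u x i) (fun j => ∀ y, d y = v y j) i := by
  rcases i with i | j
  · have hb : IsLocallyConstant fun x => u x i := (IsLocallyConstant.iff_continuous _).2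
      ((continuous_apply i).comp hφ.isInducing.continuous)
    obtain ⟨d, c', h⟩ := exists_refines_left hφ hψ c hε hb
    exact ⟨c', _, d, h, fun _ => rfl⟩
  · have hd : IsLocallyConstant fun y => v y j := (IsLocallyConstant.iff_continuous _).2
      ((continuous_apply j).comp hψ.isInducing.continuous)
    obtain ⟨b, c', h⟩ := exists_refines_right hφ hψ c hε hd
    exact ⟨c', b, _, h, fun _ => rfl⟩

end Matching

lemma exists_prefix_subset {α : Type*} [TopologicalSpace α] {U : Set (ℕ → α)} (hU : IsOpen U)
    {x : ℕ → α} (hx : x ∈ U) : ∃ N, ∀ y, (∀ k < N, y k = x k) → y ∈ U := by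
  obtain ⟨I, w, hw, hs⟩ := isOpen_pi_iff.1 hU x hx
  refine ⟨I.sup id + 1, fun y hy => hs fun i hi => ?_⟩
  rw [hy i (Nat.lt_succ_of_le (Finset.le_sup (f := id) hi))]
  exact (hw i hi).2

/-- A sequence of successively refined matchings whose bits separate points on both sides. -/
structure IsTower (φ : X → ℝ) (ψ : Y → ℝ) (u : X → ι → Bool) (v : Y → κ → Bool)
    (c : ℕ → Matching X Y) (b : ℕ → X → Bool) (d : ℕ → Y → Bool) : Prop where
  zero : ∀ x y, (c 0).p x = (c 0).q y
  refines : ∀ n, (c n).Refines φ ψ (c (n + 1)) (b n) (d n) (1 / 2 / 2 ^ n)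
  left : ∀ i, ∃ n, ∀ x, b n x = u x i
  right : ∀ j, ∃ n, ∀ y, d n y = v y j

lemma exists_isTower [T2Space X] [T2Space Y] [Nonempty X] [Nonempty Y] [Nonempty ι]
    [Countable ι] [Countable κ] (hφ : IsLelek φ u) (hψ : IsLelek ψ v) :
    ∃ c b d, IsTower φ ψ u v c b d := by
  obtain ⟨e, he⟩ := exists_surjective_nat (ι ⊕ κ)
  choose step b d h1 h2 using fun (c : Matching X Y) (n : ℕ) =>
    c.exists_refines hφ hψ (ε := 1 / 2 / 2 ^ n) (by positivity) (e n)
  let c : ℕ → Matching X Y := fun n => n.rec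
    ⟨fun _ => [], fun _ => [], IsLocallyConstant.const _, IsLocallyConstant.const _, fun a => by
      constructor <;> rintro ⟨_, h⟩
      exacts [⟨Classical.arbitrary Y, h⟩, ⟨Classical.arbitrary X, h⟩]⟩ fun n c => step c n
  refine ⟨c, fun n => b (c n) n, fun n => d (c n) n, fun _ _ => rfl, fun n => h1 (c n) n, ?_, ?_⟩
  · intro i
    obtain ⟨n, hn⟩ := he (.inl i)
    have := h2 (c n) n
    rw [hn] at this
    exact ⟨n, this⟩
  · intro j
    obtain ⟨n, hn⟩ := he (.inr j)
    have := h2 (c n) n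
    rw [hn] at this
    exact ⟨n, this⟩

namespace IsTower

variable {c : ℕ → Matching X Y} {b : ℕ → X → Bool} {d : ℕ → Y → Bool}

lemma swap (h : IsTower φ ψ u v c b d) : IsTower ψ φ v u (fun n => (c n).swap) d b :=
  ⟨fun y x => (h.zero x y).symm, fun n => (h.refines n).swap, h.right, h.left⟩

lemma p_succ (h : IsTower φ ψ u v c b d) (n : ℕ) (x : X) :
    (c (n + 1)).p x = b n x :: (c n).p x := congrFun (h.refines n).1 x

lemma q_succ (h : IsTower φ ψ u v c b d) (n : ℕ) (y : Y) :
    (c (n + 1)).q y = d n y :: (c n).q y := congrFun (h.refines n).2.1 y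

lemma continuous_bits (h : IsTower φ ψ u v c b d) : Continuous fun x n => b n x := by
  refine continuous_pi fun n => ((IsLocallyConstant.iff_continuous _).1
    (((c (n + 1)).hp).comp fun l => l.headD false)).congr fun x => ?_
  simp [h.p_succ]

lemma isInducing_bits (h : IsTower φ ψ u v c b d) (hφ : IsLelek φ u) :
    IsInducing fun x n => b n x := by
  choose N hN using h.left
  refine IsInducing.of_comp (g := fun (z : ℕ → Bool) i => z (N i)) h.continuous_bits
    (by fun_prop) ?_
  convert hφ.isInducing using 1
  ext x i
  exact hN i x

lemma p_eq_q_iff (h : IsTower φ ψ u v c b d) {x : X} {y : Y} :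
    (∀ n, (c n).p x = (c n).q y) ↔ ∀ n, b n x = d n y := by
  constructor
  · intro H n
    have := H (n + 1)
    rw [h.p_succ, h.q_succ] at this
    exact (List.cons.inj this).1
  · intro H n
    induction n with
    | zero => exact h.zero x y
    | succ n ih => rw [h.p_succ, h.q_succ, ih, H]

lemma bits_eq (h : IsTower φ ψ u v c b d) {x x' : X} {n : ℕ} (e : (c n).p x = (c n).p x') :
    ∀ k < n, b k x = b k x' := by
  induction n with
  | zero => simp
  | succ n ih =>
    rw [h.p_succ, h.p_succ] at e
    obtain ⟨e1, e2⟩ := List.cons.inj e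
    intro k hk
    rcases Nat.lt_succ_iff_lt_or_eq.1 hk with hk | rfl
    exacts [ih e2 k hk, e1]

lemma abs_gap_sub_le (h : IsTower φ ψ u v c b d) (x : X) (n : ℕ) :
    |(c n).gap φ ψ ((c n).p x) - (c 0).gap φ ψ ((c 0).p x)| ≤ 1 - 1 / 2 ^ n := by
  induction n with
  | zero => simp
  | succ n ih =>
    have := (h.refines n).2.2 x
    calc _ ≤ _ := abs_sub_le _ ((c n).gap φ ψ ((c n).p x)) _
      _ ≤ 1 / 2 / 2 ^ n + (1 - 1 / 2 ^ n) := add_le_add this ih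
      _ = _ := by field_simp; ring

lemma tendsto_infOn [T2Space X] (h : IsTower φ ψ u v c b d) (hφ : IsLelek φ u) (x : X) :
    Tendsto (fun n => infOn φ ((c n).p ⁻¹' {(c n).p x})) atTop (𝓝 (φ x)) := by
  rw [Metric.tendsto_atTop]
  intro ε hε
  obtain ⟨O, hO, hOe⟩ := (h.isInducing_bits hφ).isOpen_iff.1 (hφ.isOpen_gt (φ x - ε))
  have hx : (fun n => b n x) ∈ O := by
    change x ∈ (fun x n => b n x) ⁻¹' O
    rw [hOe]
    simp [hε]
  obtain ⟨N, hN⟩ := exists_prefix_subset hO hx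
  refine ⟨N, fun n hn => ?_⟩
  have hcl : IsClosed ((c n).p ⁻¹' {(c n).p x}) := ((c n).hp.isClopen_fiber _).1
  obtain ⟨a, ha, hae, -⟩ := hφ.exists_min hcl ⟨x, rfl⟩
  have h1 := hφ.infOn_le hcl (x := x) rfl
  have h2 : a ∈ {z | φ x - ε < φ z} := by
    rw [← hOe]
    exact hN _ fun k hk => h.bits_eq ha k (hk.trans_le hn)
  simp only [Set.mem_ofPred_eq] at h2
  rw [Real.dist_eq, abs_lt]
  constructor <;> linarith

lemma exists_forall_p_eq_q [T2Space X] [T2Space Y] (h : IsTower φ ψ u v c b d) (hφ : IsLelek φ u)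
    (hψ : IsLelek ψ v) (x : X) : ∃ y, ∀ n, (c n).p x = (c n).q y := by
  set R := φ x - (c 0).gap φ ψ ((c 0).p x) + 1 with hR
  have hcl : ∀ n, IsClosed {y | (c n).q y = (c n).p x} := fun n => ((c n).hq.isClopen_fiber _).1
  let t : ℕ → Set Y := fun n => {y | ψ y ≤ R} ∩ {y | (c n).q y = (c n).p x}
  have hsub : ∀ n, t (n + 1) ⊆ t n := by
    rintro n y ⟨hy, hy'⟩
    simp only [Set.mem_ofPred_eq, h.p_succ, h.q_succ] at hy'
    exact ⟨hy, (List.cons.inj hy').2⟩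
  have hne : ∀ n, (t n).Nonempty := by
    intro n
    obtain ⟨y, hy, hye, -⟩ := hψ.exists_min (hcl n) (((c n).nonempty_iff _).1 ⟨x, rfl⟩)
    refine ⟨y, ?_, hy⟩
    have h1 : infOn φ ((c n).p ⁻¹' {(c n).p x}) ≤ φ x :=
      hφ.infOn_le ((c n).hp.isClopen_fiber _).1 rfl
    have h2 := (abs_le.1 (h.abs_gap_sub_le x n)).1
    have h3 : (0 : ℝ) < 1 / 2 ^ n := by positivity
    have h4 : (c n).gap φ ψ ((c n).p x) = infOn φ ((c n).p ⁻¹' {(c n).p x}) - ψ y := by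
      rw [hye]; rfl
    simp only [Set.mem_ofPred_eq]
    linarith
  obtain ⟨y, hy⟩ := IsCompact.nonempty_iInter_of_sequence_nonempty_isCompact_isClosed t hsub hne
    ((hψ.isCompact_le R).inter_right (hcl 0)) fun n => (hψ.isCompact_le R).isClosed.inter (hcl n)
  exact ⟨y, fun n => (Set.mem_iInter.1 hy n).2.symm⟩

end IsTower

/-- Two Lelek-type functions agree up to a homeomorphism and the addition of a continuous
function. -/
theorem IsLelek.exists_homeomorph [T2Space X] [T2Space Y] [Nonempty X] [Nonempty Y] [Nonempty ι]
    [Countable ι] [Countable κ] (hφ : IsLelek φ u) (hψ : IsLelek ψ v) :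
    ∃ h : X ≃ₜ Y, Continuous fun x => φ x - ψ (h x) := by
  obtain ⟨c, b, d, h⟩ := exists_isTower hφ hψ
  choose f hf using h.exists_forall_p_eq_q hφ hψ
  choose g hg using h.swap.exists_forall_p_eq_q hψ hφ
  have hfb : ∀ x n, b n x = d n (f x) := fun x => h.p_eq_q_iff.1 (hf x)
  have hgb : ∀ y n, d n y = b n (g y) := fun y => h.swap.p_eq_q_iff.1 (hg y)
  have hb := h.isInducing_bits hφ
  have hd := h.swap.isInducing_bits hψ
  let H : X ≃ₜ Y :=
    { toFun := f
      invFun := g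
      left_inv := fun x => hb.injective (funext fun n => by rw [← hgb, ← hfb])
      right_inv := fun y => hd.injective (funext fun n => by rw [← hfb, ← hgb])
      continuous_toFun := hd.continuous_iff.2 <| hb.continuous.congr fun x => funext (hfb x)
      continuous_invFun := hb.continuous_iff.2 <| hd.continuous.congr fun y => funext (hgb y) }
  refine ⟨H, ?_⟩
  have hlim : ∀ x, Tendsto (fun n => (c n).gap φ ψ ((c n).p x)) atTop (𝓝 (φ x - ψ (f x))) := by
    intro x
    refine (h.tendsto_infOn hφ x).sub ((h.swap.tendsto_infOn hψ (f x)).congr fun n => ?_)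
    simp only [Matching.swap]
    rw [hf]
  have hunif : TendstoUniformly (fun n x => (c n).gap φ ψ ((c n).p x)) (fun x => φ x - ψ (f x))
      atTop := by
    rw [Metric.tendstoUniformly_iff]
    intro ε hε
    have h0 : Tendsto (fun n : ℕ => (1 : ℝ) / 2 ^ n) atTop (𝓝 0) := by
      simpa using tendsto_pow_atTop_nhds_zero_of_lt_one (r := (1 / 2 : ℝ)) (by norm_num)
        (by norm_num)
    filter_upwards [h0.eventually (gt_mem_nhds hε)] with n hn x
    rw [dist_comm]
    refine (dist_le_of_le_geometric_two_of_tendsto (C := 1) (fun m => ?_) (hlim x) n).trans_lt hn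
    rw [dist_comm]
    exact (h.refines m).2.2 x
  exact hunif.continuous <| Frequently.of_forall fun n =>
    ((c n).hp.comp ((c n).gap φ ψ)).continuous

/-- Graphs of Lelek-type functions are homeomorphic. -/
theorem IsLelek.nonempty_homeomorph [T2Space X] [T2Space Y] [Nonempty X] [Nonempty Y] [Nonempty ι]
    [Countable ι] [Countable κ] (hφ : IsLelek φ u) (hψ : IsLelek ψ v) {E E' : Type*}
    [TopologicalSpace E] [TopologicalSpace E'] (α : E ≃ X) (β : E' ≃ Y)
    (hα : IsInducing fun e => (φ (α e), α e)) (hβ : IsInducing fun e => (ψ (β e), β e)) :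
    Nonempty (E ≃ₜ E') := by
  obtain ⟨h, hh⟩ := hφ.exists_homeomorph hψ
  have cα : Continuous α := continuous_snd.comp hα.continuous
  have cβ : Continuous β := continuous_snd.comp hβ.continuous
  have cφ : Continuous (φ ∘ α) := continuous_fst.comp hα.continuous
  have cψ : Continuous (ψ ∘ β) := continuous_fst.comp hβ.continuous
  refine ⟨⟨(α.trans h.toEquiv).trans β.symm, ?_, ?_⟩⟩
  · refine hβ.continuous_iff.2 (Continuous.prodMk ?_ ?_)
    · exact (cφ.sub (hh.comp cα)).congr fun e => by simp
    · exact (h.continuous.comp cα).congr fun e => by simp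
  · refine hα.continuous_iff.2 (Continuous.prodMk ?_ ?_)
    · exact (cψ.add (hh.comp (h.symm.continuous.comp cβ))).congr fun e => by simp
    · exact (h.symm.continuous.comp cβ).congr fun e => by simp

end Matching

/-! ### The endpoint set -/

lemma calF_iterate_snd (x : ℝ × (ℕ → ℤ)) (n k : ℕ) : (calF^[n] x).2 k = x.2 (k + n) := by
  induction n generalizing k with
  | zero => rfl
  | succ n ih =>
    rw [Function.iterate_succ_apply']
    change (calF^[n] x).2 (k + 1) = _
    rw [ih, add_right_comm, add_assoc]

lemma calF_iterate_succ_fst (x : ℝ × (ℕ → ℤ)) (n : ℕ) :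
    (calF^[n + 1] x).1 = F (calF^[n] x).1 - |(x.2 n : ℝ)| := by
  rw [Function.iterate_succ_apply', calF, calF_iterate_snd, zero_add]

lemma F_mono : Monotone F := fun a b h =>
  sub_le_sub_right (Real.rpow_le_rpow_of_exponent_le (by norm_num) h) 1

lemma F_nonneg {t : ℝ} (ht : 0 ≤ t) : 0 ≤ F t := by
  have := F_mono ht
  simpa [F] using this

lemma continuous_F : Continuous F :=
  (Real.continuous_const_rpow (by norm_num)).sub continuous_const

lemma continuous_calF : Continuous calF := by
  have h : Continuous fun n : ℤ => |(n : ℝ)| := continuous_of_discreteTopology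
  refine ((continuous_F.comp continuous_fst).sub
    (h.comp ((continuous_apply 0).comp continuous_snd))).prodMk ?_
  exact continuous_pi fun n => (continuous_apply (n + 1)).comp continuous_snd

lemma log_three_mul_sub_le {a b : ℝ} (hb : 0 ≤ b) (hab : b ≤ a) :
    Real.log 3 * (a - b) ≤ F a - F b := by
  have h1 : (3 : ℝ) ^ a = 3 ^ b * 3 ^ (a - b) := by
    rw [← Real.rpow_add (by norm_num)]; congr 1; ring
  have h2 : (1 : ℝ) ≤ 3 ^ b := Real.one_le_rpow (by norm_num) hb
  have h3 : Real.log 3 * (a - b) + 1 ≤ 3 ^ (a - b) := by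
    rw [Real.rpow_def_of_pos (by norm_num)]
    exact Real.add_one_le_exp _
  have h4 : 0 ≤ Real.log 3 * (a - b) :=
    mul_nonneg (Real.log_nonneg (by norm_num)) (sub_nonneg.2 hab)
  simp only [F, h1]
  nlinarith

lemma one_lt_log_three : 1 < Real.log 3 := by
  rw [Real.lt_log_iff_exp_lt (by norm_num)]
  exact Real.exp_one_lt_d9.trans (by norm_num)

lemma isClosed_J : IsClosed J := by
  have : J = ⋂ n : ℕ, {x | 0 ≤ (calF^[n] x).1} := by ext; simp [J]
  rw [this]
  exact isClosed_iInter fun n =>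
    isClosed_le continuous_const (continuous_fst.comp (continuous_calF.iterate n))

lemma calF_iterate_fst_mono (s : ℕ → ℤ) (n : ℕ) : Monotone fun t : ℝ => (calF^[n] (t, s)).1 := by
  induction n with
  | zero => exact monotone_id
  | succ n ih =>
    intro a b hab
    simp only [calF_iterate_succ_fst]
    exact sub_le_sub_right (F_mono (ih hab)) _

lemma mem_J_of_le {s : ℕ → ℤ} {a b : ℝ} (h : (a, s) ∈ J) (hab : a ≤ b) : (b, s) ∈ J :=
  fun n => (h n).trans (calF_iterate_fst_mono s n hab)

lemma bddBelow_fiber (s : ℕ → ℤ) : BddBelow {t : ℝ | (t, s) ∈ J} := ⟨0, fun _ ht => ht 0⟩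

lemma tmin_mem_J {s : ℕ → ℤ} (hs : s ∈ Sset) : (tmin s, s) ∈ J := by
  obtain ⟨t, -, ht⟩ := hs
  exact (isClosed_J.preimage (by fun_prop : Continuous fun t : ℝ => (t, s))).csInf_mem
    ⟨t, ht⟩ (bddBelow_fiber s)

lemma tmin_le {s : ℕ → ℤ} {t : ℝ} (h : (t, s) ∈ J) : tmin s ≤ t := csInf_le (bddBelow_fiber s) h

lemma calF_iterate_fst_le {t : ℝ} {s : ℕ → ℤ} (n : ℕ) : (calF^[n] (t, s)).1 ≤ F^[n] t := by
  induction n with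
  | zero => rfl
  | succ n ih =>
    rw [calF_iterate_succ_fst, Function.iterate_succ_apply']
    exact (sub_le_self _ (abs_nonneg _)).trans (F_mono ih)

lemma isCompact_slice (r : ℝ) : IsCompact {s : ℕ → ℤ | (r, s) ∈ J} := by
  have hK : IsCompact (Set.univ.pi fun n : ℕ => Set.Icc (-⌈F^[n + 1] r⌉) ⌈F^[n + 1] r⌉) :=
    isCompact_univ_pi fun n => (Set.finite_Icc _ _).isCompact
  refine hK.of_isClosed_subset
    (isClosed_J.preimage (by fun_prop : Continuous fun s : ℕ → ℤ => (r, s))) ?_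
  intro s hs n _
  have h1 := hs (n + 1)
  rw [calF_iterate_succ_fst] at h1
  have h2 : F (calF^[n] (r, s)).1 ≤ F^[n + 1] r := by
    rw [Function.iterate_succ_apply']
    exact F_mono (calF_iterate_fst_le n)
  have h3 : |(s n : ℝ)| ≤ F^[n + 1] r := by
    have : |(((r, s) : ℝ × (ℕ → ℤ)).2 n : ℝ)| = |(s n : ℝ)| := rfl
    linarith
  rw [Set.mem_Icc, ← abs_le]
  exact_mod_cast h3.trans (Int.le_ceil _)

/-- If the orbit of a point of `J` is eventually at most one, the point is an endpoint. -/
lemma tmin_eq_of_le_one {s : ℕ → ℤ} {t : ℝ} (h : (t, s) ∈ J) {N : ℕ}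
    (hN : ∀ n, N ≤ n → (calF^[n] (t, s)).1 ≤ 1) : tmin s = t := by
  refine (tmin_le h).antisymm (le_of_not_gt fun hlt => ?_)
  have hr := tmin_mem_J ⟨t, h 0, h⟩
  set r := tmin s
  have hexp : ∀ n, Real.log 3 ^ n * (t - r) ≤ (calF^[n] (t, s)).1 - (calF^[n] (r, s)).1 := by
    intro n
    induction n with
    | zero => simp
    | succ n ih =>
      rw [calF_iterate_succ_fst, calF_iterate_succ_fst, sub_sub_sub_cancel_right, pow_succ',
        mul_assoc]
      exact (mul_le_mul_of_nonneg_left ih (by linarith [one_lt_log_three])).trans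
        (log_three_mul_sub_le (hr n) (calF_iterate_fst_mono s n hlt.le))
  have hlim : Tendsto (fun n => Real.log 3 ^ n * (t - r)) atTop atTop :=
    (tendsto_pow_atTop_atTop_of_one_lt one_lt_log_three).atTop_mul_const (sub_pos.2 hlt)
  obtain ⟨n, hn, hn1⟩ := ((hlim.eventually_gt_atTop 1).and (eventually_ge_atTop N)).exists
  linarith [hexp n, hN n hn1, hr n]

/-- Any point of `J` lies above an endpoint address sharing a prescribed prefix: the height is
realized as a minimal height after changing the tail of the address. -/
lemma exists_tmin_eq {s : ℕ → ℤ} {t : ℝ} (h : (t, s) ∈ J) (N : ℕ) :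
    ∃ s', (∀ k < N, s' k = s k) ∧ (t, s') ∈ J ∧ tmin s' = t := by
  let digit : ℕ → ℝ → ℤ := fun n τ => if n < N then s n else ⌊F τ⌋
  let τ : ℕ → ℝ := fun n => n.rec t fun n τ => F τ - |(digit n τ : ℝ)|
  let s' : ℕ → ℤ := fun n => digit n (τ n)
  have hτs : ∀ n, τ (n + 1) = F (τ n) - |(s' n : ℝ)| := fun n => rfl
  have hτ : ∀ n, (calF^[n] (t, s')).1 = τ n := by
    intro n
    induction n with
    | zero => rfl
    | succ n ih => rw [calF_iterate_succ_fst, ih, hτs]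
  have hlo : ∀ n, n < N → s' n = s n := fun n hn => by simp [s', digit, hn]
  have hhi : ∀ n, N ≤ n → s' n = ⌊F (τ n)⌋ := fun n hn => by simp [s', digit, hn.not_gt]
  have hpre : ∀ n ≤ N, τ n = (calF^[n] (t, s)).1 := by
    intro n hn
    induction n with
    | zero => rfl
    | succ n ih => rw [calF_iterate_succ_fst, hτs, ih (by omega), hlo n hn]
  have hfract : ∀ n, N ≤ n → 0 ≤ τ n → τ (n + 1) = Int.fract (F (τ n)) := fun n hn h0 => by
    rw [hτs, hhi n hn, abs_of_nonneg (by exact_mod_cast Int.floor_nonneg.2 (F_nonneg h0))]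
    rfl
  have hnn : ∀ n, 0 ≤ τ n := by
    intro n
    induction n with
    | zero => exact h 0
    | succ n ih =>
      rcases lt_or_ge n N with hn | hn
      · rw [hpre _ hn]; exact h _
      · rw [hfract n hn ih]; exact Int.fract_nonneg _
  have hJ : (t, s') ∈ J := fun n => (hτ n).symm ▸ hnn n
  refine ⟨s', hlo, hJ, tmin_eq_of_le_one hJ (N := N + 1) fun n hn => ?_⟩
  obtain ⟨m, rfl⟩ := Nat.exists_eq_add_of_le' hn
  rw [hτ, ← add_assoc, hfract _ (by omega) (hnn _)]
  exact (Int.fract_lt_one _).le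

/-- Evaluation of the coordinates of a sequence through a coding of each coordinate. -/
lemma isInducing_coordinate_code {α κ : Type*} [TopologicalSpace α] {f : α → κ → Bool}
    (hf : IsInducing f) :
    IsInducing fun (s : ℕ → α) (i : ℕ × κ) => f (s i.1) i.2 :=
  (Homeomorph.piCurry (X := ℕ) (Y := κ) (Z := Bool)).symm.isInducing.comp
    (IsInducing.piMap fun _ : ℕ => hf)

lemma isInducing_int_code : IsInducing fun (n k : ℤ) => decide (n = k) := by
  refine isInducing_iff_nhds.2 fun n => ?_
  rw [nhds_discrete]
  refine le_antisymm (Filter.map_le_iff_le_comap.1 ?_) ?_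
  · exact pure_le_nhds _
  · have : {z : ℤ → Bool | z n = true} ∈ 𝓝 fun k => decide (n = k) :=
      ((isOpen_discrete ({true} : Set Bool)).preimage
        (continuous_apply (A := fun _ => Bool) n)).mem_nhds (by simp)
    refine (Filter.comap_mono (Filter.le_principal_iff.2 this)).trans ?_
    rw [Filter.comap_principal, ← Filter.principal_singleton, Filter.principal_mono]
    intro k hk
    simpa using hk

lemma isLelek_tmin :
    IsLelek (fun s : Sset => tmin s) fun s (i : ℕ × ℤ) => decide ((s : ℕ → ℤ) i.1 = i.2) where
  isInducing := (isInducing_coordinate_code isInducing_int_code).comp IsInducing.subtypeVal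
  isCompact_le r := by
    rw [IsInducing.subtypeVal.isCompact_iff]
    convert isCompact_slice r using 1
    ext s
    constructor
    · rintro ⟨⟨s, hs⟩, h, rfl⟩
      exact mem_J_of_le (tmin_mem_J hs) h
    · intro h
      exact ⟨⟨s, r, h 0, h⟩, tmin_le h, rfl⟩
  exists_eq := by
    rintro U hU ⟨s, hs⟩ hsU t ht
    obtain ⟨O, hO, rfl⟩ := isOpen_induced_iff.1 hU
    obtain ⟨N, hN⟩ := exists_prefix_subset hO hsU
    obtain ⟨s', h1, h2, h3⟩ := exists_tmin_eq (mem_J_of_le (tmin_mem_J hs) ht) N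
    exact ⟨⟨s', t, h2 0, h2⟩, hN _ h1, h3⟩

lemma zero_mem_Sset : (0 : ℕ → ℤ) ∈ Sset := by
  refine ⟨0, le_rfl, fun n => ?_⟩
  have : calF (0, 0) = (0, 0) := by
    refine Prod.ext ?_ rfl
    simp [calF, F]
  rw [Function.iterate_fixed this]

/-- Endpoints are determined by their addresses. -/
def efanEquiv : Efan ≃ Sset where
  toFun x := ⟨x.1.2, x.2.1⟩
  invFun s := ⟨(tmin s, s), s.2, rfl⟩
  left_inv x := Subtype.ext (Prod.ext x.2.2.symm rfl)
  right_inv _ := rfl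

lemma isInducing_efanEquiv : IsInducing fun x => (tmin (efanEquiv x : ℕ → ℤ), efanEquiv x) := by
  refine IsInducing.of_comp (g := Prod.map id (Subtype.val : Sset → _)) ?_ (by fun_prop) ?_
  · refine Continuous.prodMk ?_ ?_
    · exact (continuous_fst.comp continuous_subtype_val).congr fun x => x.2.2
    · exact (continuous_snd.comp continuous_subtype_val).subtype_mk _
  · convert IsInducing.subtypeVal (t := Efan) using 1
    ext x : 1
    exact Prod.ext x.2.2.symm rfl

/-! ### Complete Erdős space -/

/-- The convergent sequence `{0} ∪ {1 / (m + 1) : m ∈ ℕ}`. -/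
def unitFractions : Set ℝ := insert 0 (Set.range fun m : ℕ => 1 / ((m : ℝ) + 1))

lemma isCompact_unitFractions : IsCompact unitFractions :=
  tendsto_one_div_add_atTop_nhds_zero_nat.isCompact_insert_range

lemma isInducing_unitFractions_code :
    IsInducing fun (x : unitFractions) (m : ℕ) => decide ((x : ℝ) = 1 / ((m : ℝ) + 1)) := by
  have : CompactSpace unitFractions := isCompact_iff_compactSpace.1 isCompact_unitFractions
  refine (Continuous.isClosedEmbedding ?_ ?_).isInducing
  · refine continuous_pi fun m => (continuous_bool_rng true).2 ⟨?_, ?_⟩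
    · convert (isClosed_singleton (x := 1 / ((m : ℝ) + 1))).preimage
        (continuous_subtype_val : Continuous (Subtype.val : unitFractions → ℝ)) using 1
      ext x; simp
    · have hm : (0 : ℝ) < 1 / ((m : ℝ) + 1) := by positivity
      have hfin : {x : ℝ | x ∈ unitFractions ∧ 1 / ((m : ℝ) + 2) < x}.Finite := by
        refine ((Set.finite_Iic m).image fun k : ℕ => 1 / ((k : ℝ) + 1)).subset ?_
        rintro x ⟨rfl | ⟨k, rfl⟩, hx⟩
        · exact absurd hx (not_lt.2 (by positivity))
        · refine ⟨k, ?_, rfl⟩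
          simp only at hx
          rw [one_div_lt_one_div (by positivity) (by positivity)] at hx
          have : (k : ℝ) < m + 1 := by linarith
          exact Nat.lt_succ_iff.1 (by exact_mod_cast this)
      have hcl : IsClosed ({x : ℝ | x ∈ unitFractions ∧ 1 / ((m : ℝ) + 2) < x} \
          {1 / ((m : ℝ) + 1)}) := (hfin.subset Set.sdiff_subset).isClosed
      convert (hcl.isOpen_compl.inter (isOpen_lt continuous_const continuous_id :
        IsOpen {x : ℝ | 1 / ((m : ℝ) + 2) < x})).preimage
        (continuous_subtype_val : Continuous (Subtype.val : unitFractions → ℝ)) using 1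
      ext ⟨x, hx⟩
      have : 1 / ((m : ℝ) + 2) < 1 / ((m : ℝ) + 1) :=
        one_div_lt_one_div_of_lt (by positivity) (by linarith)
      simp only [Set.mem_preimage, Set.mem_singleton_iff, decide_eq_true_eq, Set.mem_inter_iff,
        Set.mem_compl_iff, Set.mem_sdiff, Set.mem_ofPred_eq]
      constructor
      · rintro rfl
        exact ⟨fun h => h.2 rfl, this⟩
      · rintro ⟨h1, h2⟩
        by_contra h3
        exact h1 ⟨⟨hx, h2⟩, h3⟩
  · rintro ⟨x, hx⟩ ⟨y, hy⟩ h
    have h' : ∀ m : ℕ, x = 1 / ((m : ℝ) + 1) ↔ y = 1 / ((m : ℝ) + 1) := fun m => by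
      simpa using congrFun h m
    refine Subtype.ext ?_
    rcases hx with rfl | ⟨m, rfl⟩
    · rcases hy with rfl | ⟨k, rfl⟩
      · rfl
      · exact (h' k).2 rfl
    · exact ((h' m).1 rfl).symm

/-- Square summable sequences of unit fractions and zeros. -/
def erdosSeq : Set (ℕ → ℝ) := {x | (∀ n, x n ∈ unitFractions) ∧ Summable fun n => x n ^ 2}

/-- The square of the `ℓ²`-norm. -/
def sqNorm (x : ℕ → ℝ) : ℝ := ∑' n, x n ^ 2

lemma isInducing_erdosSeq_code : IsInducing fun (x : erdosSeq) (i : ℕ × ℕ) =>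
    decide ((x : ℕ → ℝ) i.1 = 1 / ((i.2 : ℝ) + 1)) := by
  have h : IsInducing fun (x : erdosSeq) (n : ℕ) => (⟨x.1 n, x.2.1 n⟩ : unitFractions) := by
    refine IsInducing.of_comp (g := fun z n => (z n : ℝ)) (continuous_pi fun n => ?_)
      (by fun_prop) IsInducing.subtypeVal
    exact ((continuous_apply n).comp continuous_subtype_val).subtype_mk _
  exact (isInducing_coordinate_code isInducing_unitFractions_code).comp h

lemma isCompact_sqNorm_le (r : ℝ) : IsCompact {x | x ∈ erdosSeq ∧ sqNorm x ≤ r} := by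
  have h : {x | x ∈ erdosSeq ∧ sqNorm x ≤ r} = (Set.univ.pi fun _ : ℕ => unitFractions) ∩
      ⋂ N : ℕ, {x | ∑ n ∈ Finset.range N, x n ^ 2 ≤ r} := by
    ext x
    simp only [erdosSeq, sqNorm, Set.mem_ofPred_eq, Set.mem_inter_iff, Set.mem_univ_pi,
      Set.mem_iInter]
    constructor
    · rintro ⟨⟨h1, h2⟩, h3⟩
      exact ⟨h1, fun N => (h2.sum_le_tsum _ fun n _ => sq_nonneg _).trans h3⟩
    · rintro ⟨h1, h2⟩
      have := summable_of_sum_range_le (fun n => sq_nonneg (x n)) h2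
      exact ⟨⟨h1, this⟩, this.tsum_le_of_sum_range_le h2⟩
  rw [h]
  refine (isCompact_univ_pi fun _ => isCompact_unitFractions).inter_right
    (isClosed_iInter fun N => isClosed_le ?_ continuous_const)
  fun_prop

/-- A unit fraction whose square is comparable with `r` from below. -/
lemma exists_unitFraction_sq_le {r : ℝ} (hr : 0 ≤ r) :
    ∃ z ∈ unitFractions, z ^ 2 ≤ r ∧ min r 1 ≤ 4 * z ^ 2 := by
  rcases hr.eq_or_lt with rfl | hr
  · exact ⟨0, Or.inl rfl, by simp, by simp⟩
  have hs : 0 < √r := Real.sqrt_pos.2 hr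
  have hsq : √r ^ 2 = r := Real.sq_sqrt hr.le
  refine ⟨1 / ((⌊1 / √r⌋₊ : ℝ) + 1), Or.inr ⟨_, rfl⟩, ?_, ?_⟩
  · refine (pow_le_pow_left₀ (by positivity) ?_ 2).trans_eq hsq
    rw [one_div_le (by positivity) hs]
    exact (Nat.lt_floor_add_one (1 / √r)).le
  · have hf : (⌊1 / √r⌋₊ : ℝ) ≤ 1 / √r := Nat.floor_le (by positivity)
    set k : ℝ := (⌊1 / √r⌋₊ : ℝ) + 1 with hk
    have hk0 : 0 < k := by positivity
    have h1 : min (√r) 1 * k ≤ 2 := by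
      have e1 : k ≤ 1 / √r + 1 := by linarith
      have e2 : min (√r) 1 * (1 / √r) ≤ 1 := by
        rw [mul_one_div, div_le_one hs]; exact min_le_left _ _
      have e3 : min (√r) 1 ≤ 1 := min_le_right _ _
      have e0 : 0 ≤ min (√r) 1 := le_min hs.le zero_le_one
      nlinarith [mul_le_mul_of_nonneg_left e1 e0]
    have h2 : min r 1 = min (√r) 1 ^ 2 := by
      rcases le_total (√r) 1 with h | h
      · rw [min_eq_left h, hsq, min_eq_left]
        rw [← hsq]; exact pow_le_one₀ hs.le h
      · rw [min_eq_right h, one_pow, min_eq_right]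
        rw [← hsq]; exact one_le_pow₀ h
    rw [h2, one_div, inv_pow, ← div_eq_mul_inv, le_div_iff₀ (by positivity), ← mul_pow]
    have e0 : 0 ≤ min (√r) 1 * k := mul_nonneg (le_min hs.le zero_le_one) hk0.le
    nlinarith

lemma exists_sqNorm_eq {x : ℕ → ℝ} (hx : x ∈ erdosSeq) {t : ℝ} (ht : sqNorm x ≤ t) (N : ℕ) :
    ∃ x' ∈ erdosSeq, (∀ k < N, x' k = x k) ∧ sqNorm x' = t := by
  choose! z hz hzle hzmin using fun r (hr : 0 ≤ r) => exists_unitFraction_sq_le hr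
  let digit : ℕ → ℝ → ℝ := fun n ρ => if n < N then x n else z ρ
  let ρ : ℕ → ℝ := fun n => n.rec t fun n ρ => ρ - digit n ρ ^ 2
  let x' : ℕ → ℝ := fun n => digit n (ρ n)
  have hρs : ∀ n, ρ (n + 1) = ρ n - x' n ^ 2 := fun n => rfl
  have hlo : ∀ n, n < N → x' n = x n := fun n hn => by simp [x', digit, hn]
  have hhi : ∀ n, N ≤ n → x' n = z (ρ n) := fun n hn => by simp [x', digit, hn.not_gt]
  have hsum : ∀ n, ∑ k ∈ Finset.range n, x' k ^ 2 = t - ρ n := by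
    intro n
    induction n with
    | zero => exact (sub_self t).symm
    | succ n ih => rw [Finset.sum_range_succ, ih, hρs]; ring
  have hnn : ∀ n, 0 ≤ ρ n := by
    intro n
    rcases le_total n N with hn | hn
    · have h1 : ∑ k ∈ Finset.range n, x' k ^ 2 = ∑ k ∈ Finset.range n, x k ^ 2 :=
        Finset.sum_congr rfl fun k hk => by rw [hlo k ((Finset.mem_range.1 hk).trans_le hn)]
      have h2 : ∑ k ∈ Finset.range n, x k ^ 2 ≤ sqNorm x :=
        hx.2.sum_le_tsum _ fun n _ => sq_nonneg _
      linarith [hsum n]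
    · induction n, hn using Nat.le_induction with
      | base =>
        have h1 : ∑ k ∈ Finset.range N, x' k ^ 2 = ∑ k ∈ Finset.range N, x k ^ 2 :=
          Finset.sum_congr rfl fun k hk => by rw [hlo k (Finset.mem_range.1 hk)]
        have h2 : ∑ k ∈ Finset.range N, x k ^ 2 ≤ sqNorm x :=
          hx.2.sum_le_tsum _ fun n _ => sq_nonneg _
        linarith [hsum N]
      | succ n hn ih =>
        rw [hρs, hhi n hn]
        linarith [hzle _ ih]
  have hsummable : Summable fun n => x' n ^ 2 :=
    summable_of_sum_range_le (c := t) (fun n => sq_nonneg _) fun n => by linarith [hsum n, hnn n]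
  have hmem : ∀ n, x' n ∈ unitFractions := fun n => by
    rcases lt_or_ge n N with hn | hn
    · rw [hlo n hn]; exact hx.1 n
    · rw [hhi n hn]; exact hz _ (hnn n)
  have hlim : Tendsto (fun n => min (ρ n) 1) atTop (𝓝 0) := by
    have h4 : Tendsto (fun n => 4 * x' n ^ 2) atTop (𝓝 0) := by
      simpa using hsummable.tendsto_atTop_zero.const_mul 4
    refine squeeze_zero' (Eventually.of_forall fun n => le_min (hnn n) zero_le_one) ?_ h4
    filter_upwards [eventually_ge_atTop N] with n hn
    rw [hhi n hn]
    exact hzmin _ (hnn n)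
  have hρ : Tendsto ρ atTop (𝓝 0) := by
    refine hlim.congr' ?_
    filter_upwards [hlim.eventually (gt_mem_nhds one_pos)] with n hn
    exact min_eq_left ((min_lt_iff.1 hn).resolve_right (lt_irrefl 1)).le
  refine ⟨x', ⟨hmem, hsummable⟩, hlo, HasSum.tsum_eq ?_⟩
  rw [hasSum_iff_tendsto_nat_of_nonneg fun n => sq_nonneg _]
  simp only [hsum]
  simpa using hρ.const_sub t

lemma isLelek_sqNorm : IsLelek (fun x : erdosSeq => sqNorm x) fun x (i : ℕ × ℕ) =>
    decide ((x : ℕ → ℝ) i.1 = 1 / ((i.2 : ℝ) + 1)) where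
  isInducing := isInducing_erdosSeq_code
  isCompact_le r := by
    rw [IsInducing.subtypeVal.isCompact_iff]
    convert isCompact_sqNorm_le r using 1
    ext x
    constructor
    · rintro ⟨x, h, rfl⟩
      exact ⟨x.2, h⟩
    · rintro ⟨h1, h2⟩
      exact ⟨⟨x, h1⟩, h2, rfl⟩
  exists_eq := by
    rintro U hU ⟨x, hx⟩ hxU t ht
    obtain ⟨O, hO, rfl⟩ := isOpen_induced_iff.1 hU
    obtain ⟨N, hN⟩ := exists_prefix_subset hO hxU
    obtain ⟨x', h1, h2, h3⟩ := exists_sqNorm_eq hx ht N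
    exact ⟨⟨x', h1⟩, hN _ h2, h3⟩

lemma memlp_two_iff {x : ℕ → ℝ} : Memℓp x 2 ↔ Summable fun n => x n ^ 2 := by
  rw [memℓp_gen_iff (by norm_num)]
  simp

/-- Points of complete Erdős space as real sequences. -/
def ecEquiv : Ec ≃ erdosSeq where
  toFun x := ⟨x.1, fun n => (x.2 n).imp id fun ⟨m, hm⟩ => ⟨m, hm.symm⟩,
    memlp_two_iff.1 (lp.memℓp x.1)⟩
  invFun x := ⟨⟨x.1, memlp_two_iff.2 x.2.2⟩,
    fun n => (x.2.1 n).imp id fun ⟨m, hm⟩ => ⟨m, hm.symm⟩⟩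
  left_inv _ := rfl
  right_inv _ := rfl

lemma sqNorm_coe (x : lp (fun _ : ℕ => ℝ) 2) : sqNorm x = ‖x‖ ^ 2 := by
  have := lp.norm_rpow_eq_tsum (p := 2) (by norm_num) x
  simp only [ENNReal.toReal_ofNat, Real.rpow_ofNat, Real.norm_eq_abs, sq_abs] at this
  exact this.symm

/-- The tail estimate bounding the `ℓ²`-distance by coordinates and norms. -/
lemma sqNorm_sub_le (x a : lp (fun _ : ℕ => ℝ) 2) (N : ℕ) :
    ‖x - a‖ ^ 2 ≤ ∑ n ∈ Finset.range N, (x n - a n) ^ 2 +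
      (2 * (‖x‖ ^ 2 - ∑ n ∈ Finset.range N, x n ^ 2) +
      2 * (‖a‖ ^ 2 - ∑ n ∈ Finset.range N, a n ^ 2)) := by
  have hs : ∀ y : lp (fun _ : ℕ => ℝ) 2, Summable fun n => y n ^ 2 :=
    fun y => memlp_two_iff.1 (lp.memℓp y)
  have ht : ∀ y : lp (fun _ : ℕ => ℝ) 2, ‖y‖ ^ 2 - ∑ n ∈ Finset.range N, y n ^ 2 =
      ∑' n, y (n + N) ^ 2 := fun y => by
    rw [← sqNorm_coe, sqNorm, ← (hs y).sum_add_tsum_nat_add N, add_sub_cancel_left]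
  have hs' : ∀ y : lp (fun _ : ℕ => ℝ) 2, Summable fun n => y (n + N) ^ 2 :=
    fun y => (summable_nat_add_iff N).2 (hs y)
  have h0 := ht (x - a)
  rw [sub_eq_iff_eq_add'] at h0
  rw [h0, ht, ht, ← tsum_mul_left, ← tsum_mul_left,
    ← ((hs' x).mul_left 2).tsum_add ((hs' a).mul_left 2)]
  refine add_le_add (le_of_eq rfl) ((hs' (x - a)).tsum_le_tsum (fun n => ?_)
    (((hs' x).mul_left 2).add ((hs' a).mul_left 2)))
  change (x (n + N) - a (n + N)) ^ 2 ≤ _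
  nlinarith [sq_nonneg (x (n + N) + a (n + N))]

/-- On `ℓ²` the norm topology is given by coordinates together with the norm. -/
lemma isInducing_sqNorm_coe :
    IsInducing fun x : lp (fun _ : ℕ => ℝ) 2 => (sqNorm x, (x : ℕ → ℝ)) := by
  have hc : Continuous fun x : lp (fun _ : ℕ => ℝ) 2 => (sqNorm x, (x : ℕ → ℝ)) := by
    simp only [sqNorm_coe]
    exact (continuous_norm.pow 2).prodMk (lp.uniformContinuous_coe.continuous)
  refine isInducing_iff_nhds.2 fun a => le_antisymm (hc.tendsto a).le_comap ?_
  rw [Metric.nhds_basis_ball.ge_iff]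
  intro ε hε
  have hlim : Tendsto (fun N => 2 * (‖a‖ ^ 2 - ∑ n ∈ Finset.range N, a n ^ 2) +
      2 * (‖a‖ ^ 2 - ∑ n ∈ Finset.range N, a n ^ 2)) atTop (𝓝 0) := by
    have h1 : HasSum (fun n => a n ^ 2) (‖a‖ ^ 2) := by
      rw [← sqNorm_coe]
      exact (memlp_two_iff.1 (lp.memℓp a)).hasSum
    have h2 := (h1.tendsto_sum_nat.const_sub (‖a‖ ^ 2)).const_mul 2
    simpa using h2.add h2
  obtain ⟨N, hN⟩ := (hlim.eventually (gt_mem_nhds (pow_pos hε 2))).exists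
  let G : ℝ × (ℕ → ℝ) → ℝ := fun z => ∑ n ∈ Finset.range N, (z.2 n - a n) ^ 2 +
      (2 * (z.1 - ∑ n ∈ Finset.range N, z.2 n ^ 2) +
      2 * (‖a‖ ^ 2 - ∑ n ∈ Finset.range N, a n ^ 2))
  have hG : Continuous G := by fun_prop
  have hGa : G (sqNorm a, a) < ε ^ 2 := by simpa [G, sqNorm_coe] using hN
  refine Filter.mem_comap.2 ⟨_, (isOpen_lt hG continuous_const).mem_nhds hGa, fun x hx => ?_⟩
  have hx' : G (sqNorm x, x) < ε ^ 2 := hx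
  simp only [G, sqNorm_coe] at hx'
  rw [mem_ball_iff_norm]
  exact lt_of_pow_lt_pow_left₀ 2 hε.le ((sqNorm_sub_le x a N).trans_lt hx')

lemma isInducing_ecEquiv : IsInducing fun x => (sqNorm (ecEquiv x), ecEquiv x) := by
  have h := isInducing_sqNorm_coe.comp (IsInducing.subtypeVal (t := ErdosSet))
  refine IsInducing.of_comp (g := Prod.map id (Subtype.val : erdosSeq → _)) ?_ (by fun_prop) h
  exact (continuous_fst.comp h.continuous).prodMk
    ((continuous_snd.comp h.continuous).subtype_mk _)

/-- The endpoint set E(𝓕), with its subspace topology from ℝ × ℤ^ω,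
is homeomorphic to complete Erdős space 𝔈_c. -/
theorem endpoint_set_homeomorphic_Ec : Nonempty (↥Efan ≃ₜ Ec) := by
  have : Nonempty Sset := ⟨⟨0, zero_mem_Sset⟩⟩
  have : Nonempty erdosSeq := ⟨ecEquiv ⟨0, fun _ => Or.inl rfl⟩⟩
  exact isLelek_tmin.nonempty_homeomorph isLelek_sqNorm efanEquiv ecEquiv isInducing_efanEquiv
    isInducing_ecEquiv
end
end
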